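/- Let τ belong to class 𝒯 with invariant density h = dμ/dm (P_τ h = h, ∫ h dm = 1). Then there exist constants H > 0 and 0 < q < 1 such that for all f ∈ BV_I and all n ≥ 1, ‖P_τ^n f − (∫_I f dm)·h‖_BV ≤ H·q^n·‖f‖_BV; i.e., P_τ = Ψ + Q where Ψ f = (∫ f dm)·h is the projection onto the eigenspace E₁, QΨ = 0, and ‖Q^n‖_BV ≤ H·q^n. -/

import Mathlib

open Set Filter MeasureTheory Topology

structure PCT where
  τ : ℝ → ℝ
  a : ℕ → ℝ
  b : ℕ → ℝ
  da : ℕ → ℝ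
  maps_to : Set.MapsTo τ (Set.Icc 0 1) (Set.Icc 0 1)
  lt : ∀ i, a i < b i
  sub : ∀ i, Set.Ioo (a i) (b i) ⊆ Set.Icc (0:ℝ) 1
  disj : Pairwise (Function.onFun Disjoint fun i => Set.Ioo (a i) (b i))
  null : volume (Set.Icc (0:ℝ) 1 \ ⋃ i, Set.Ioo (a i) (b i)) = 0
  mono : ∀ i, StrictMonoOn τ (Set.Ioo (a i) (b i))
  conv : ∀ i, ConvexOn ℝ (Set.Ioo (a i) (b i)) τ
  diff : ∀ i, ∀ x ∈ Set.Ioo (a i) (b i), DifferentiableAt ℝ τ x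
  lim_zero : ∀ i, Filter.Tendsto τ (nhdsWithin (a i) (Set.Ioi (a i))) (nhds 0)
  deriv_lim : ∀ i, Filter.Tendsto (deriv τ) (nhdsWithin (a i) (Set.Ioi (a i))) (nhds (da i))
  da_pos : ∀ i, 0 < da i
  sum_inv : Summable (fun i => 1 / da i)
  expand : (¬ AccPt (0:ℝ) (Filter.principal (Set.range a))) → ∃ i, a i = 0 ∧ 1 < da i

/-- The interval `(c,d)` follows a single sequence of branches under the first `n`
iterates of `τ`. -/
def IsBranchSeq (T : PCT) (n : ℕ) (c d : ℝ) : Prop :=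
  c < d ∧ ∀ k < n, ∃ i, T.τ^[k] '' Set.Ioo c d ⊆ Set.Ioo (T.a i) (T.b i)

/-- `(c,d)` is a maximal open interval on which `τ^n` is a single monotone branch,
i.e. an element of the partition `𝒫⁽ⁿ⁾`. -/
def IsBranchInterval (T : PCT) (n : ℕ) (c d : ℝ) : Prop :=
  IsBranchSeq T n c d ∧
    ∀ c' d', c' ≤ c → d ≤ d' → IsBranchSeq T n c' d' → c' = c ∧ d' = d

/-- Lebesgue measure on the unit interval. -/
noncomputable abbrev unitMeasure : Measure ℝ := volume.restrict (Icc 0 1)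

/-- The distribution function of an integrable function on the unit interval. -/
noncomputable def cumulative (u : ℝ →₁[unitMeasure] ℝ) (x : ℝ) : ℝ :=
  ∫ t in Iic x, u t ∂unitMeasure

/-- `F` is the distribution function of a nonincreasing probability density on `[0,1]`
bounded by `K`. -/
structure IsConcaveCdf (K : ℝ) (F : ℝ → ℝ) : Prop where
  mono : MonotoneOn F (Icc 0 1)
  conc : ConcaveOn ℝ (Icc 0 1) F
  zero : F 0 = 0
  one : F 1 = 1
  le : ∀ x ∈ Icc (0:ℝ) 1, F x ≤ K * x

lemma cumulative_add (u v : ℝ →₁[unitMeasure] ℝ) (x : ℝ) :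
    cumulative (u + v) x = cumulative u x + cumulative v x := by
  unfold cumulative
  rw [← integral_add (L1.integrable_coeFn u).integrableOn (L1.integrable_coeFn v).integrableOn]
  exact integral_congr_ae (ae_restrict_of_ae (Lp.coeFn_add u v))

lemma cumulative_smul (c : ℝ) (u : ℝ →₁[unitMeasure] ℝ) (x : ℝ) :
    cumulative (c • u) x = c * cumulative u x := by
  unfold cumulative
  rw [← integral_const_mul]
  exact integral_congr_ae (ae_restrict_of_ae (Lp.coeFn_smul c u))

lemma cumulative_sub (u v : ℝ →₁[unitMeasure] ℝ) (x : ℝ) :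
    cumulative (u - v) x = cumulative u x - cumulative v x := by
  have := cumulative_add (u - v) v x
  rw [sub_add_cancel] at this
  linarith

lemma cumulative_zero_right (u : ℝ →₁[unitMeasure] ℝ) : cumulative u 0 = 0 := by
  unfold cumulative
  rw [Measure.restrict_restrict measurableSet_Iic]
  have : Iic (0:ℝ) ∩ Icc 0 1 = {0} := by
    ext x; simp only [mem_inter_iff, mem_Iic, mem_Icc, mem_singleton_iff]
    constructor
    · rintro ⟨h1, h2, -⟩; linarith
    · rintro rfl; norm_num
  rw [this]; simp

lemma cumulative_one_right (u : ℝ →₁[unitMeasure] ℝ) :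
    cumulative u 1 = ∫ t, u t ∂unitMeasure := by
  unfold cumulative
  rw [Measure.restrict_restrict measurableSet_Iic,
    inter_eq_self_of_subset_right fun x hx => hx.2]

lemma cumulative_sub_cumulative (u : ℝ →₁[unitMeasure] ℝ) {x y : ℝ} (hxy : x ≤ y) :
    cumulative u y - cumulative u x = ∫ t in Ioc x y, u t ∂unitMeasure := by
  unfold cumulative
  rw [intervalIntegral.integral_Iic_sub_Iic (L1.integrable_coeFn u).integrableOn
    (L1.integrable_coeFn u).integrableOn, intervalIntegral.integral_of_le hxy]

lemma continuous_cumulative (x : ℝ) :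
    Continuous fun u : ℝ →₁[unitMeasure] ℝ => cumulative u x :=
  continuous_setIntegral (Iic x)

lemma isClosed_isConcaveCdf (K : ℝ) :
    IsClosed {u : ℝ →₁[unitMeasure] ℝ | IsConcaveCdf K (cumulative u)} := by
  refine isClosed_of_closure_subset fun u hu => ?_
  obtain ⟨w, hw, hlim⟩ := mem_closure_iff_seq_limit.1 hu
  have hx (x : ℝ) : Tendsto (fun n => cumulative (w n) x) atTop (𝓝 (cumulative u x)) :=
    ((continuous_cumulative x).tendsto u).comp hlim
  refine ⟨fun x hx' y hy' hxy => ?_, ⟨convex_Icc 0 1, fun x hx' y hy' a b ha hb hab => ?_⟩,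
    cumulative_zero_right u, ?_, fun x hx' => ?_⟩
  · exact le_of_tendsto_of_tendsto' (hx x) (hx y) fun n => (hw n).mono hx' hy' hxy
  · exact le_of_tendsto_of_tendsto' (((hx x).const_smul a).add ((hx y).const_smul b)) (hx _)
      fun n => (hw n).conc.2 hx' hy' ha hb hab
  · exact tendsto_nhds_unique (hx 1) (by simp [fun n => (hw n).one])
  · exact le_of_tendsto' (hx x) fun n => (hw n).le x hx'

lemma ConcaveOn.sub_mul_le {F : ℝ → ℝ} (hF : ConcaveOn ℝ (Icc 0 1) F) (h0 : F 0 = 0) {x y : ℝ}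
    (hx : 0 ≤ x) (hxy : x ≤ y) (hy : y ≤ 1) : (F y - F x) * x ≤ F x * (y - x) := by
  rcases (hx.trans hxy).eq_or_lt with h | h
  · have : x = 0 := by linarith
    subst this; subst h; simp
  have := hF.2 (show y ∈ Icc (0:ℝ) 1 from ⟨by linarith, hy⟩)
    (show (0:ℝ) ∈ Icc (0:ℝ) 1 from ⟨le_rfl, zero_le_one⟩)
    (show 0 ≤ x / y by positivity) (show 0 ≤ 1 - x / y by
      rw [sub_nonneg]; exact (div_le_one h).2 hxy) (by ring)
  simp only [smul_eq_mul, h0, mul_zero, add_zero] at this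
  rw [div_mul_cancel₀ _ h.ne', div_mul_eq_mul_div, div_le_iff₀ h] at this
  linarith

lemma ConcaveOn.mul_le_sub {F : ℝ → ℝ} (hF : ConcaveOn ℝ (Icc 0 1) F)
    (hm : MonotoneOn F (Icc 0 1)) {x y : ℝ}
    (hx : 0 ≤ x) (hxy : x ≤ y) (hy : y ≤ 1) : (F 1 - F y) * (y - x) ≤ F y - F x := by
  have h1 : F y ≤ F 1 := hm ⟨hx.trans hxy, hy⟩ ⟨zero_le_one, le_rfl⟩ hy
  have h2 : F x ≤ F y := hm ⟨hx, hxy.trans hy⟩ ⟨hx.trans hxy, hy⟩ hxy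
  rcases hxy.eq_or_lt with rfl | hxy
  · simp
  rcases hy.eq_or_lt with rfl | hy
  · simpa using h2
  have := hF.slope_anti_adjacent (x := x) (y := y) (z := 1) ⟨hx, by linarith⟩
    ⟨zero_le_one, le_rfl⟩ hxy hy
  rw [div_le_div_iff₀ (by linarith) (by linarith)] at this
  nlinarith

namespace IsConcaveCdf

variable {K : ℝ} {F : ℝ → ℝ}

lemma le_one (hF : IsConcaveCdf K F) {x : ℝ} (hx : x ∈ Icc (0:ℝ) 1) : F x ≤ 1 := by
  have := hF.mono hx (by simp) hx.2
  rwa [hF.one] at this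

lemma one_le (hF : IsConcaveCdf K F) : 1 ≤ K := by
  simpa [hF.one] using hF.le 1 (by simp)

lemma sub_le (hF : IsConcaveCdf K F) {x y : ℝ} (hx : 0 ≤ x) (hxy : x ≤ y) (hy : y ≤ 1) :
    F y - F x ≤ K * (y - x) := by
  rcases hx.eq_or_lt with rfl | hx
  · simpa [hF.zero] using hF.le y ⟨hxy, hy⟩
  have h1 := hF.conc.sub_mul_le hF.zero hx.le hxy hy
  have h2 := hF.le x ⟨hx.le, by linarith⟩
  have : (F y - F x) * x ≤ (K * (y - x)) * x := by nlinarith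
  exact le_of_mul_le_mul_right this hx

end IsConcaveCdf

/-- A density with concave distribution function has a nonincreasing version. -/
lemma IsConcaveCdf.exists_antitone_version {K : ℝ} {u : ℝ →₁[unitMeasure] ℝ}
    (hu : IsConcaveCdf K (cumulative u)) :
    ∃ g : ℝ → ℝ, g =ᵐ[unitMeasure] u ∧ Antitone g ∧ ∀ x, g x ∈ Icc 0 K := by
  set F := cumulative u with hFdef
  have hui : IntervalIntegrable u volume 0 1 := by
    rw [intervalIntegrable_iff_integrableOn_Icc_of_le zero_le_one]
    exact L1.integrable_coeFn u
  have hFi : ∀ x ∈ Icc (0:ℝ) 1, F x = ∫ t in (0:ℝ)..x, u t := fun x hx => by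
    have h := cumulative_sub_cumulative u hx.1
    have hs : Ioc 0 x ⊆ Icc (0:ℝ) 1 := fun t ht => ⟨ht.1.le, ht.2.trans hx.2⟩
    rw [cumulative_zero_right, sub_zero, Measure.restrict_restrict measurableSet_Ioc,
      inter_eq_self_of_subset_left hs] at h
    rw [hFdef, h, intervalIntegral.integral_of_le hx.1]
  let G : Set ℝ := {x | x ∈ Ioo (0:ℝ) 1 ∧ HasDerivAt F (u x) x}
  have hG : ∀ᵐ x ∂unitMeasure, x ∈ G := by
    rw [ae_restrict_iff' measurableSet_Icc]
    have h0 : ∀ᵐ x : ℝ, x ≠ 0 := by simp [ae_iff, measure_singleton]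
    have h1 : ∀ᵐ x : ℝ, x ≠ 1 := by simp [ae_iff, measure_singleton]
    filter_upwards [hui.ae_hasDerivAt_integral, h0, h1] with x hx h0 h1 hmem
    rw [uIcc_of_le zero_le_one] at hx
    have hmem' : x ∈ Ioo (0:ℝ) 1 := ⟨lt_of_le_of_ne hmem.1 h0.symm, lt_of_le_of_ne hmem.2 h1⟩
    refine ⟨hmem', (hx hmem 0 (by simp)).congr_of_eventuallyEq ?_⟩
    filter_upwards [Ioo_mem_nhds hmem'.1 hmem'.2] with y hy
    exact hFi y ⟨hy.1.le, hy.2.le⟩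
  have hanti : AntitoneOn u G := by
    intro x hx y hy hxy
    rcases hxy.eq_or_lt with rfl | hxy
    · rfl
    exact (hu.conc.le_slope_of_hasDerivAt (Ioo_subset_Icc_self hx.1)
      (Ioo_subset_Icc_self hy.1) hxy hy.2).trans (hu.conc.slope_le_of_hasDerivAt
      (Ioo_subset_Icc_self hx.1) (Ioo_subset_Icc_self hy.1) hxy hx.2)
  have hbd : ∀ x ∈ G, u x ∈ Icc 0 K := by
    intro x hx
    constructor
    · refine le_trans ?_ (hu.conc.slope_le_of_hasDerivAt (Ioo_subset_Icc_self hx.1)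
        (y := 1) (by simp) hx.1.2 hx.2)
      rw [slope_def_field]
      have := hu.le_one (Ioo_subset_Icc_self hx.1)
      exact div_nonneg (by rw [hu.one]; linarith) (by linarith [hx.1.2])
    · refine (hu.conc.le_slope_of_hasDerivAt (x := 0) (by simp) (Ioo_subset_Icc_self hx.1)
        hx.1.1 hx.2).trans ?_
      rw [slope_def_field, hu.zero, sub_zero, sub_zero, div_le_iff₀ hx.1.1]
      exact hu.le x (Ioo_subset_Icc_self hx.1)
  obtain ⟨g, hg, hgu⟩ := hanti.exists_antitone_extension
    ⟨0, by rintro _ ⟨x, hx, rfl⟩; exact (hbd x hx).1⟩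
    ⟨K, by rintro _ ⟨x, hx, rfl⟩; exact (hbd x hx).2⟩
  have hK : 0 ≤ K := zero_le_one.trans hu.one_le
  refine ⟨fun x => min K (max 0 (g x)), ?_, fun x y hxy => ?_, fun x => ?_⟩
  · filter_upwards [hG] with x hx
    rw [← hgu hx, max_eq_right (hbd x hx).1, min_eq_right (hbd x hx).2]
  · exact min_le_min le_rfl (max_le_max le_rfl (hg hxy))
  · exact ⟨le_min hK (le_max_left _ _), min_le_left _ _⟩

lemma IsConcaveCdf.norm_le {K : ℝ} {u : ℝ →₁[unitMeasure] ℝ}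
    (hu : IsConcaveCdf K (cumulative u)) : ‖u‖ ≤ 1 := by
  obtain ⟨g, hg, -, hg'⟩ := hu.exists_antitone_version
  rw [L1.norm_eq_integral_norm, ← hu.one, cumulative_one_right]
  refine (integral_congr_ae ?_).le
  filter_upwards [hg] with x hx
  rw [← hx, Real.norm_of_nonneg (hg' x).1]

lemma cumulative_sub_mem_Icc {u : ℝ →₁[unitMeasure] ℝ} {f : ℝ → ℝ} (huf : u =ᵐ[unitMeasure] f)
    {x y c d : ℝ} (hx : 0 ≤ x) (hxy : x ≤ y) (hy : y ≤ 1) (hf : ∀ t ∈ Ioc x y, f t ∈ Icc c d) :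
    cumulative u y - cumulative u x ∈ Icc (c * (y - x)) (d * (y - x)) := by
  have hs : Ioc x y ⊆ Icc (0:ℝ) 1 := fun t ht => ⟨hx.trans ht.1.le, ht.2.trans hy⟩
  have hmeas : unitMeasure.restrict (Ioc x y) = volume.restrict (Ioc x y) := by
    rw [Measure.restrict_restrict measurableSet_Ioc, inter_eq_self_of_subset_left hs]
  have hintg : IntegrableOn u (Ioc x y) := by
    have : IntegrableOn u (Ioc x y) unitMeasure := (L1.integrable_coeFn u).integrableOn
    rwa [IntegrableOn, hmeas] at this
  have hae : ∀ᵐ t ∂volume.restrict (Ioc x y), u t ∈ Icc c d := by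
    rw [← hmeas]
    filter_upwards [ae_restrict_of_ae huf, ae_restrict_mem measurableSet_Ioc] with t ht ht'
    rw [ht]; exact hf t ht'
  have hconst (e : ℝ) : ∫ _ in Ioc x y, e = e * (y - x) := by
    rw [setIntegral_const, Real.volume_real_Ioc_of_le hxy, smul_eq_mul, mul_comm]
  rw [cumulative_sub_cumulative u hxy, hmeas, ← hconst c, ← hconst d]
  constructor
  · exact integral_mono_ae (by simp) hintg (hae.mono fun t ht => ht.1)
  · exact integral_mono_ae hintg (by simp) (hae.mono fun t ht => ht.2)

lemma exists_smul_isConcaveCdf_of_pos {K M : ℝ} (hK : 2 ≤ K) (hM : 0 < M) {f : ℝ → ℝ}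
    (hf : AntitoneOn f (Icc 0 1)) (hfM : ∀ x ∈ Icc (0:ℝ) 1, f x ∈ Icc M (2 * M))
    (u : ℝ →₁[unitMeasure] ℝ) (huf : u =ᵐ[unitMeasure] f) :
    ∃ (m : ℝ) (g : ℝ →₁[unitMeasure] ℝ), m ∈ Icc 0 (2 * M) ∧ IsConcaveCdf K (cumulative g) ∧
      u = m • g := by
  have hbd : ∀ {x y : ℝ}, 0 ≤ x → x ≤ y → y ≤ 1 →
      cumulative u y - cumulative u x ∈ Icc (M * (y - x)) (2 * M * (y - x)) :=
    fun hx hxy hy => cumulative_sub_mem_Icc huf hx hxy hy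
      fun t ht => hfM t ⟨hx.trans ht.1.le, ht.2.trans hy⟩
  have h0 := cumulative_zero_right u
  have h1 := hbd le_rfl zero_le_one le_rfl
  rw [h0, sub_zero, sub_zero, mul_one, mul_one] at h1
  set m := cumulative u 1
  have hm : 0 < m := hM.trans_le h1.1
  have hmono : MonotoneOn (cumulative u) (Icc 0 1) := fun x hx y hy hxy => by
    have := (hbd hx.1 hxy hy.2).1
    nlinarith
  have hconc : ConcaveOn ℝ (Icc 0 1) (cumulative u) := by
    refine concaveOn_of_slope_anti_adjacent (convex_Icc 0 1) fun {x y z} hx hz hxy hyz => ?_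
    have hy : y ∈ Icc (0:ℝ) 1 := ⟨hx.1.trans hxy.le, hyz.le.trans hz.2⟩
    have h2 := (cumulative_sub_mem_Icc (c := f z) (d := f y) huf hy.1 hyz.le hz.2 fun t ht =>
      have ht' : t ∈ Icc (0:ℝ) 1 := ⟨hy.1.trans ht.1.le, ht.2.trans hz.2⟩
      ⟨hf ht' hz ht.2, hf hy ht' ht.1.le⟩).2
    have h3 := (cumulative_sub_mem_Icc (c := f y) (d := f x) huf hx.1 hxy.le hy.2 fun t ht =>
      have ht' : t ∈ Icc (0:ℝ) 1 := ⟨hx.1.trans ht.1.le, ht.2.trans hy.2⟩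
      ⟨hf ht' hy ht.2, hf hx ht' ht.1.le⟩).1
    exact ((div_le_iff₀ (by linarith)).2 h2).trans ((le_div_iff₀ (by linarith)).2 h3)
  have hfun : cumulative (m⁻¹ • u) = fun x => m⁻¹ * cumulative u x :=
    funext (cumulative_smul _ _)
  refine ⟨m, m⁻¹ • u, ⟨hm.le, h1.2⟩, ?_, (smul_inv_smul₀ hm.ne' u).symm⟩
  rw [hfun]
  refine ⟨fun x hx y hy hxy => ?_, hconc.smul (inv_nonneg.2 hm.le), by simp [h0], ?_,
    fun x hx => ?_⟩
  · exact mul_le_mul_of_nonneg_left (hmono hx hy hxy) (inv_nonneg.2 hm.le)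
  · exact inv_mul_cancel₀ hm.ne'
  · have := (hbd le_rfl hx.1 hx.2).2
    rw [h0, sub_zero, sub_zero] at this
    rw [inv_mul_le_iff₀ hm]
    nlinarith [mul_le_mul h1.1 hK zero_le_two hm.le, mul_nonneg hm.le hx.1, hx.1]

/-- The constant density. -/
noncomputable def unitDensity : ℝ →₁[unitMeasure] ℝ :=
  (integrable_const (1:ℝ)).toL1 fun _ => 1

lemma isConcaveCdf_unitDensity {K : ℝ} (hK : 1 ≤ K) :
    IsConcaveCdf K (cumulative unitDensity) := by
  have h (x : ℝ) (hx : x ∈ Icc (0:ℝ) 1) : cumulative unitDensity x = x := by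
    have := cumulative_sub_mem_Icc (c := 1) (d := 1) (Integrable.coeFn_toL1 _ : unitDensity =ᵐ[_] _)
      le_rfl hx.1 hx.2 fun t _ => ⟨le_rfl, le_rfl⟩
    rw [cumulative_zero_right, sub_zero, sub_zero, one_mul] at this
    exact le_antisymm this.2 this.1
  refine ⟨fun x hx y hy hxy => by rwa [h x hx, h y hy], ?_, h 0 (by simp), h 1 (by simp),
    fun x hx => ?_⟩
  · exact (concaveOn_id (convex_Icc 0 1)).congr fun x hx => (h x hx).symm
  · rw [h x hx]; exact le_mul_of_one_le_left hx.1 hK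

/-- A nonincreasing function with values in `[M, 2M]` is a multiple of a nonincreasing density. -/
lemma exists_smul_isConcaveCdf {K M : ℝ} (hK : 2 ≤ K) (hM : 0 ≤ M) {f : ℝ → ℝ}
    (hf : AntitoneOn f (Icc 0 1)) (hfM : ∀ x ∈ Icc (0:ℝ) 1, f x ∈ Icc M (2 * M))
    (u : ℝ →₁[unitMeasure] ℝ) (huf : u =ᵐ[unitMeasure] f) :
    ∃ (m : ℝ) (g : ℝ →₁[unitMeasure] ℝ), m ∈ Icc 0 (2 * M) ∧ IsConcaveCdf K (cumulative g) ∧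
      u = m • g := by
  rcases hM.eq_or_lt with rfl | hM
  · refine ⟨0, unitDensity, by simp, isConcaveCdf_unitDensity (by linarith), ?_⟩
    rw [zero_smul]
    refine Lp.ext ?_
    filter_upwards [huf, Lp.coeFn_zero ℝ 1 unitMeasure, ae_restrict_mem measurableSet_Icc]
      with x hx h0 hmem
    have := hfM x hmem
    rw [hx, h0]
    simp only [mul_zero, Icc_self, mem_singleton_iff] at this
    simpa using this
  · exact exists_smul_isConcaveCdf_of_pos hK hM hf hfM u huf

/-- A function of bounded variation is a difference of multiples of nonincreasing densities. -/
lemma exists_decomposition {K : ℝ} (hK : 2 ≤ K) {f : ℝ → ℝ} (hfi : Integrable f unitMeasure)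
    (hf : BoundedVariationOn f (Icc 0 1)) :
    ∃ (m₁ m₂ : ℝ) (g₁ g₂ : ℝ →₁[unitMeasure] ℝ),
      m₁ ∈ Icc 0 (6 * ((∫ x, |f x| ∂unitMeasure) + (eVariationOn f (Icc 0 1)).toReal)) ∧
      m₂ ∈ Icc 0 (6 * ((∫ x, |f x| ∂unitMeasure) + (eVariationOn f (Icc 0 1)).toReal)) ∧
      IsConcaveCdf K (cumulative g₁) ∧ IsConcaveCdf K (cumulative g₂) ∧
      hfi.toL1 f = m₁ • g₁ - m₂ • g₂ := by
  set V := (eVariationOn f (Icc 0 1)).toReal with hV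
  set B := (∫ x, |f x| ∂unitMeasure) + V with hB
  have hV0 : 0 ≤ V := ENNReal.toReal_nonneg
  have hintg : 0 ≤ ∫ x, |f x| ∂unitMeasure := integral_nonneg fun _ => abs_nonneg _
  have hbd : ∀ x ∈ Icc (0:ℝ) 1, |f x| ≤ B := by
    intro x hx
    have hdist : ∀ y ∈ Icc (0:ℝ) 1, |f x| - V ≤ |f y| := fun y hy => by
      have h1 := hf.dist_le hx hy
      rw [Real.dist_eq] at h1
      have h2 := abs_sub_abs_le_abs_sub (f x) (f y)
      linarith
    have : ∫ _, (|f x| - V) ∂unitMeasure ≤ ∫ y, |f y| ∂unitMeasure :=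
      integral_mono_ae (integrable_const _) hfi.abs
        ((ae_restrict_mem measurableSet_Icc).mono hdist)
    simp at this
    linarith
  have hB0 : 0 ≤ B := add_nonneg hintg hV0
  have hloc := hf.locallyBoundedVariationOn
  have h0 : (0:ℝ) ∈ Icc (0:ℝ) 1 := by simp
  set p := variationOnFromTo f (Icc 0 1) 0 with hp
  have hpm : MonotoneOn p (Icc 0 1) := variationOnFromTo.monotoneOn hloc h0
  have hqm : MonotoneOn (p - f) (Icc 0 1) := variationOnFromTo.sub_self_monotoneOn hloc h0
  have hpV : ∀ x ∈ Icc (0:ℝ) 1, p x ∈ Icc 0 V := fun x hx =>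
    ⟨variationOnFromTo.nonneg_of_le f _ hx.1,
      (le_abs_self _).trans (variationOnFromTo.abs_le_eVariationOn hf)⟩
  have hbddInt : ∀ {g : ℝ → ℝ}, AntitoneOn g (Icc 0 1) → Integrable g unitMeasure := fun hg =>
    hg.integrableOn_isCompact isCompact_Icc
  have hanti₁ : AntitoneOn (fun x => 5 * B - (p x - f x)) (Icc 0 1) := fun x hx y hy hxy => by
    have := hqm hx hy hxy
    simp only [Pi.sub_apply] at this
    linarith
  have hanti₂ : AntitoneOn (fun x => 5 * B - p x) (Icc 0 1) := fun x hx y hy hxy => by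
    have := hpm hx hy hxy
    linarith
  obtain ⟨m₁, g₁, hm₁, hg₁, h₁⟩ := exists_smul_isConcaveCdf hK (M := 3 * B) (by positivity) hanti₁
    (fun x hx => by
      have h1 := hpV x hx
      have h2 := abs_le.1 (hbd x hx)
      constructor <;> linarith [h1.1, h1.2]) _ (hbddInt hanti₁).coeFn_toL1
  obtain ⟨m₂, g₂, hm₂, hg₂, h₂⟩ := exists_smul_isConcaveCdf hK (M := 3 * B) (by positivity) hanti₂
    (fun x hx => by
      have h1 := hpV x hx
      constructor <;> linarith [h1.1, h1.2]) _ (hbddInt hanti₂).coeFn_toL1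
  refine ⟨m₁, m₂, g₁, g₂, ⟨hm₁.1, by linarith [hm₁.2]⟩, ⟨hm₂.1, by linarith [hm₂.2]⟩, hg₁, hg₂, ?_⟩
  rw [← h₁, ← h₂, ← Integrable.toL1_sub]
  congr 1
  ext x
  simp

namespace PCT

variable (T : PCT)

lemma a_nonneg (i : ℕ) : 0 ≤ T.a i := by
  have h := closure_mono (T.sub i)
  rw [closure_Ioo (T.lt i).ne, isClosed_Icc.closure_eq] at h
  exact (h (left_mem_Icc.2 (T.lt i).le)).1

lemma b_le_one (i : ℕ) : T.b i ≤ 1 := by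
  have h := closure_mono (T.sub i)
  rw [closure_Ioo (T.lt i).ne, isClosed_Icc.closure_eq] at h
  exact (h (right_mem_Icc.2 (T.lt i).le)).2

lemma b_le_a_of_a_lt {i j : ℕ} (h : T.a i < T.a j) : T.b i ≤ T.a j := by
  have hij : i ≠ j := by rintro rfl; exact lt_irrefl _ h
  by_contra! hb
  have hd := Set.disjoint_left.1 (T.disj hij)
  obtain ⟨x, hx1, hx2⟩ := exists_between (lt_min hb (T.lt j))
  exact hd ⟨h.trans hx1, hx2.trans_le (min_le_left _ _)⟩ ⟨hx1, hx2.trans_le (min_le_right _ _)⟩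

lemma a_injective : Function.Injective T.a := by
  intro i j h
  by_contra hij
  have hd := Set.disjoint_left.1 (T.disj hij)
  obtain ⟨x, hx1, hx2⟩ := exists_between (lt_min (T.lt i) (h.trans_lt (T.lt j)))
  exact hd ⟨hx1, hx2.trans_le (min_le_left _ _)⟩ ⟨h ▸ hx1, hx2.trans_le (min_le_right _ _)⟩

lemma da_mul_le (i : ℕ) {t : ℝ} (ht : t ∈ Ioo (T.a i) (T.b i)) :
    T.da i * (t - T.a i) ≤ T.τ t := by
  have hev : ∀ᶠ s in 𝓝[>] (T.a i), deriv T.τ s * (t - s) ≤ T.τ t - T.τ s := by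
    filter_upwards [Ioo_mem_nhdsGT ht.1] with s hs
    have hs' : s ∈ Ioo (T.a i) (T.b i) := ⟨hs.1, hs.2.trans ht.2⟩
    have := (T.conv i).le_slope_of_hasDerivAt hs' ht hs.2 (T.diff i s hs').hasDerivAt
    rwa [slope_def_field, le_div_iff₀ (sub_pos.2 hs.2)] at this
  have hid : Tendsto (fun s => t - s) (𝓝[>] (T.a i)) (𝓝 (t - T.a i)) :=
    ((continuous_const.sub continuous_id).tendsto _).mono_left nhdsWithin_le_nhds
  have := le_of_tendsto_of_tendsto ((T.deriv_lim i).mul hid)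
    (tendsto_const_nhds.sub (T.lim_zero i)) hev
  simpa using this

/-- The extended inverse of the `i`-th branch: it is constant equal to `b i` to the right of
the image of the branch. -/
noncomputable def inv (i : ℕ) (x : ℝ) : ℝ :=
  sSup (insert (T.a i) {t | t ∈ Ioo (T.a i) (T.b i) ∧ T.τ t ≤ x})

lemma le_b_of_mem_inv_set {i : ℕ} {x t : ℝ}
    (ht : t ∈ insert (T.a i) {t | t ∈ Ioo (T.a i) (T.b i) ∧ T.τ t ≤ x}) : t ≤ T.b i := by
  rcases ht with rfl | ht
  exacts [(T.lt i).le, ht.1.2.le]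

lemma bddAbove_inv_set (i : ℕ) (x : ℝ) :
    BddAbove (insert (T.a i) {t | t ∈ Ioo (T.a i) (T.b i) ∧ T.τ t ≤ x}) :=
  ⟨T.b i, fun _ ht => T.le_b_of_mem_inv_set ht⟩

lemma inv_mem (i : ℕ) (x : ℝ) : T.inv i x ∈ Icc (T.a i) (T.b i) :=
  ⟨le_csSup (T.bddAbove_inv_set i x) (mem_insert _ _),
    csSup_le (insert_nonempty _ _) fun _ ht => T.le_b_of_mem_inv_set ht⟩

lemma inv_mem_unit (i : ℕ) (x : ℝ) : T.inv i x ∈ Icc (0:ℝ) 1 :=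
  ⟨(T.a_nonneg i).trans (T.inv_mem i x).1, (T.inv_mem i x).2.trans (T.b_le_one i)⟩

lemma a_mem_unit (i : ℕ) : T.a i ∈ Icc (0:ℝ) 1 :=
  ⟨T.a_nonneg i, (T.lt i).le.trans (T.b_le_one i)⟩

lemma le_inv {i : ℕ} {x t : ℝ} (ht : t ∈ Ioo (T.a i) (T.b i)) (hx : T.τ t ≤ x) :
    t ≤ T.inv i x :=
  le_csSup (T.bddAbove_inv_set i x) (mem_insert_of_mem _ ⟨ht, hx⟩)

lemma inv_sub_le (i : ℕ) {x : ℝ} (hx : 0 ≤ x) : T.inv i x - T.a i ≤ x / T.da i := by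
  rw [sub_le_iff_le_add]
  refine csSup_le (insert_nonempty _ _) ?_
  rintro t (rfl | ⟨ht, htx⟩)
  · have := div_nonneg hx (T.da_pos i).le
    linarith
  · have : t - T.a i ≤ x / T.da i := by
      rw [le_div_iff₀ (T.da_pos i)]
      linarith [T.da_mul_le i ht]
    linarith

lemma inv_one (i : ℕ) : T.inv i 1 = T.b i := by
  refine le_antisymm (T.inv_mem i 1).2 (le_of_forall_lt_imp_le_of_dense fun t ht => ?_)
  rcases le_or_gt t (T.a i) with h | h
  · exact h.trans (T.inv_mem i 1).1
  · exact T.le_inv ⟨h, ht⟩ (T.maps_to (T.sub i ⟨h, ht⟩)).2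

lemma inv_mono (i : ℕ) : Monotone (T.inv i) := fun _ y hxy =>
  csSup_le_csSup (T.bddAbove_inv_set i y) (insert_nonempty _ _)
    (insert_subset_insert fun _ ht => ⟨ht.1, ht.2.trans hxy⟩)

lemma τ_le_of_lt_inv {i : ℕ} {x t : ℝ} (hat : T.a i < t) (ht : t < T.inv i x) : T.τ t ≤ x := by
  obtain ⟨s, hs, hts⟩ := exists_lt_of_lt_csSup (insert_nonempty _ _) ht
  rcases hs with rfl | ⟨hs, hsx⟩
  · exact absurd (hat.trans hts) (lt_irrefl _)
  · exact ((T.mono i) ⟨hat, hts.trans hs.2⟩ hs hts).le.trans hsx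

lemma τ_combination_le (i : ℕ) {t c d : ℝ} (ht : t ∈ Ioo (T.a i) (T.b i)) (hc : 0 ≤ c)
    (hd : 0 < d) (hcd : c + d = 1) :
    c * T.a i + d * t ∈ Ioo (T.a i) (T.b i) ∧ T.τ (c * T.a i + d * t) ≤ d * T.τ t := by
  have hmem : c * T.a i + d * t ∈ Ioo (T.a i) (T.b i) := by
    obtain rfl : c = 1 - d := by linarith
    constructor
    · nlinarith [mul_pos hd (sub_pos.2 ht.1)]
    · nlinarith [mul_pos hd (sub_pos.2 ht.2), mul_nonneg hc (sub_nonneg.2 (T.lt i).le)]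
  refine ⟨hmem, ?_⟩
  have hev : ∀ᶠ s in 𝓝[>] (T.a i), T.τ (c * s + d * t) ≤ c * T.τ s + d * T.τ t := by
    filter_upwards [Ioo_mem_nhdsGT (T.lt i)] with s hs
    exact (T.conv i).2 hs ht hc hd.le hcd
  have hleft : Tendsto (fun s => T.τ (c * s + d * t)) (𝓝[>] (T.a i))
      (𝓝 (T.τ (c * T.a i + d * t))) :=
    ((T.diff i _ hmem).continuousAt.tendsto.comp
      ((by fun_prop : Continuous fun s : ℝ => c * s + d * t).tendsto (T.a i))).mono_left
      nhdsWithin_le_nhds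
  have := le_of_tendsto_of_tendsto hleft
    (((T.lim_zero i).const_mul c).add_const (d * T.τ t)) hev
  simpa using this

lemma inv_concave (i : ℕ) : ConcaveOn ℝ (Icc 0 1) (T.inv i) := by
  refine ⟨convex_Icc 0 1, fun x hx y hy c d hc hd hcd => ?_⟩
  simp only [smul_eq_mul]
  rcases hc.eq_or_lt with rfl | hc'
  · obtain rfl : d = 1 := by linarith
    simp
  rcases hd.eq_or_lt with rfl | hd'
  · obtain rfl : c = 1 := by linarith
    simp
  have key := map_mem_closure₂ (f := fun s t : ℝ => c * s + d * t)
    (u := Iic (T.inv i (c * x + d * y))) (by fun_prop)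
    (csSup_mem_closure (insert_nonempty _ _) (T.bddAbove_inv_set i x))
    (csSup_mem_closure (insert_nonempty _ _) (T.bddAbove_inv_set i y)) ?_
  · rwa [isClosed_Iic.closure_eq] at key
  rintro s (rfl | ⟨hs, hsx⟩) t (rfl | ⟨ht, hty⟩)
  · change c * T.a i + d * T.a i ≤ _
    rw [← add_mul, hcd, one_mul]
    exact (T.inv_mem i _).1
  · obtain ⟨hm, hle⟩ := T.τ_combination_le i ht hc hd' hcd
    exact T.le_inv hm (by nlinarith [mul_nonneg hc hx.1])
  · obtain ⟨hm, hle⟩ := T.τ_combination_le i hs hd hc' ((add_comm _ _).trans hcd)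
    change c * s + d * T.a i ≤ _
    rw [add_comm]
    exact T.le_inv hm (by nlinarith [mul_nonneg hd hy.1])
  · refine T.le_inv ((T.conv i).1 hs ht hc hd hcd) (((T.conv i).2 hs ht hc hd hcd).trans ?_)
    simp only [smul_eq_mul]
    nlinarith

/-- The preimage of an initial segment is a union of initial segments of the branches. -/
lemma preimage_Iic_ae_eq {x : ℝ} :
    (T.τ ⁻¹' Iic x : Set ℝ) =ᵐ[unitMeasure] ⋃ i, Ioc (T.a i) (T.inv i x) := by
  have h1 : ∀ᵐ t ∂unitMeasure, t ∈ ⋃ i, Ioo (T.a i) (T.b i) := by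
    rw [ae_restrict_iff' measurableSet_Icc, ae_iff]
    refine measure_mono_null (fun t ht => ?_) T.null
    simpa [and_assoc] using ht
  have h2 : ∀ᵐ t ∂unitMeasure, t ∉ range fun i => T.inv i x :=
    ae_restrict_of_ae ((countable_range _).ae_notMem _)
  filter_upwards [h1, h2] with t ht ht2
  refine propext ?_
  change T.τ t ≤ x ↔ t ∈ ⋃ i, Ioc (T.a i) (T.inv i x)
  rw [mem_iUnion] at ht ⊢
  constructor
  · intro h
    obtain ⟨i, hi⟩ := ht
    exact ⟨i, hi.1, T.le_inv hi h⟩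
  · rintro ⟨i, hi⟩
    exact T.τ_le_of_lt_inv hi.1 (lt_of_le_of_ne hi.2 fun h => ht2 ⟨i, h.symm⟩)

lemma disjoint_Ioc_inv (x : ℝ) :
    Pairwise (Function.onFun Disjoint fun i => Ioc (T.a i) (T.inv i x)) := by
  intro i j hij
  rcases lt_or_gt_of_ne (T.a_injective.ne hij) with h | h
  · exact Set.disjoint_left.2 fun t ht ht' =>
      absurd ((ht.2.trans (T.inv_mem i x).2).trans (T.b_le_a_of_a_lt h)) (not_le.2 ht'.1)
  · exact Set.disjoint_left.2 fun t ht ht' =>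
      absurd ((ht'.2.trans (T.inv_mem j x).2).trans (T.b_le_a_of_a_lt h)) (not_le.2 ht.1)

end PCT

/-- `L` is the Frobenius–Perron operator of `T`, acting on `L¹[0,1]`. -/
structure IsTransferOperator (T : PCT) (L : (ℝ →₁[unitMeasure] ℝ) →L[ℝ] (ℝ →₁[unitMeasure] ℝ)) :
    Prop where
  norm_le : ∀ u, ‖L u‖ ≤ ‖u‖
  setIntegral_eq : ∀ u s, MeasurableSet s →
    ∫ x in s, L u x ∂unitMeasure = ∫ x in T.τ ⁻¹' s, u x ∂unitMeasure

/-- An operator on functions satisfying the defining relation of the Frobenius–Perron operator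
descends to `L¹[0,1]`. -/
lemma exists_isTransferOperator (T : PCT) (P : (ℝ → ℝ) → (ℝ → ℝ))
    (hP : ∀ f : ℝ → ℝ, IntegrableOn f (Icc (0:ℝ) 1) →
      IntegrableOn (P f) (Icc (0:ℝ) 1) ∧
      ∀ A : Set ℝ, MeasurableSet A → A ⊆ Icc (0:ℝ) 1 →
        ∫ x in A, P f x = ∫ x in T.τ ⁻¹' A ∩ Icc (0:ℝ) 1, f x) :
    ∃ L, IsTransferOperator T L ∧ ∀ (u : ℝ →₁[unitMeasure] ℝ) (f : ℝ → ℝ),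
      u =ᵐ[unitMeasure] f → L u =ᵐ[unitMeasure] P f := by
  have hintg {f : ℝ → ℝ} (hf : Integrable f unitMeasure) : Integrable (P f) unitMeasure :=
    (hP f hf).1
  have hset {f : ℝ → ℝ} (hf : Integrable f unitMeasure) {s : Set ℝ} (hs : MeasurableSet s) :
      ∫ x in s, P f x ∂unitMeasure = ∫ x in T.τ ⁻¹' s, f x ∂unitMeasure := by
    have h := (hP f hf).2 (s ∩ Icc 0 1) (hs.inter measurableSet_Icc) inter_subset_right
    rw [Measure.restrict_restrict' measurableSet_Icc, Measure.restrict_restrict' measurableSet_Icc,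
      h]
    congr 2
    ext x
    simp only [mem_inter_iff, mem_preimage]
    exact ⟨fun hx => ⟨hx.1.1, hx.2⟩, fun hx => ⟨⟨hx.1, T.maps_to hx.2⟩, hx.2⟩⟩
  have hcongr {f g : ℝ → ℝ} (hf : Integrable f unitMeasure) (hg : Integrable g unitMeasure)
      (hfg : f =ᵐ[unitMeasure] g) : P f =ᵐ[unitMeasure] P g := by
    refine (hintg hf).ae_eq_of_forall_setIntegral_eq _ _ (hintg hg) fun s hs _ => ?_
    rw [hset hf hs, hset hg hs]
    exact integral_congr_ae (ae_restrict_of_ae hfg)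
  have hadd {f g : ℝ → ℝ} (hf : Integrable f unitMeasure) (hg : Integrable g unitMeasure) :
      P (f + g) =ᵐ[unitMeasure] P f + P g := by
    refine (hintg (hf.add hg)).ae_eq_of_forall_setIntegral_eq _ _ ((hintg hf).add (hintg hg))
      fun s hs _ => ?_
    rw [hset (hf.add hg) hs, integral_add' hf.integrableOn hg.integrableOn,
      integral_add' (hintg hf).integrableOn (hintg hg).integrableOn, hset hf hs, hset hg hs]
  have hsmul (c : ℝ) {f : ℝ → ℝ} (hf : Integrable f unitMeasure) :
      P (c • f) =ᵐ[unitMeasure] c • P f := by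
    refine (hintg (hf.smul c)).ae_eq_of_forall_setIntegral_eq _ _ ((hintg hf).smul c)
      fun s hs _ => ?_
    rw [hset (hf.smul c) hs]
    simp only [Pi.smul_apply, integral_smul, hset hf hs]
  have hnonneg {f : ℝ → ℝ} (hf : Integrable f unitMeasure) (hf0 : ∀ x, 0 ≤ f x) :
      0 ≤ᵐ[unitMeasure] P f := by
    refine ae_nonneg_of_forall_setIntegral_nonneg (hintg hf) fun s hs _ => ?_
    rw [hset hf hs]
    exact integral_nonneg hf0
  have hnorm {f : ℝ → ℝ} (hf : Integrable f unitMeasure) :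
      ∫ x, ‖P f x‖ ∂unitMeasure ≤ ∫ x, ‖f x‖ ∂unitMeasure := by
    have habs : ∀ᵐ x ∂unitMeasure, ‖P f x‖ ≤ P (fun t => |f t|) x := by
      have h1 := hnonneg (f := (fun t => |f t|) + f) (hf.abs.add hf) fun x => by
        have := neg_abs_le (f x)
        simp only [Pi.add_apply]; linarith
      have h2 := hnonneg (f := (fun t => |f t|) + (-1 : ℝ) • f) (hf.abs.add (hf.smul _))
        fun x => by
          have := le_abs_self (f x)
          simp only [Pi.add_apply, Pi.smul_apply, smul_eq_mul]; linarith
      filter_upwards [h1, h2, hadd hf.abs hf, hadd hf.abs (hf.smul (-1 : ℝ)), hsmul (-1) hf]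
        with x h1 h2 h3 h4 h5
      simp only [Pi.zero_apply, h3, h4, h5, Pi.add_apply, Pi.smul_apply, smul_eq_mul] at h1 h2
      rw [Real.norm_eq_abs, abs_le]
      constructor <;> linarith
    refine (integral_mono_ae (hintg hf).norm (hintg hf.abs) habs).trans ?_
    have := hset hf.abs MeasurableSet.univ
    rw [preimage_univ, Measure.restrict_univ] at this
    exact this.le
  let i (u : ℝ →₁[unitMeasure] ℝ) := L1.integrable_coeFn u
  let L₀ : (ℝ →₁[unitMeasure] ℝ) →ₗ[ℝ] (ℝ →₁[unitMeasure] ℝ) :=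
    { toFun := fun u => (hintg (i u)).toL1 (P u)
      map_add' := fun u v => by
        rw [← Integrable.toL1_add, Integrable.toL1_eq_toL1_iff]
        exact (hcongr (i _) ((i u).add (i v)) (Lp.coeFn_add u v)).trans (hadd (i u) (i v))
      map_smul' := fun c u => by
        rw [RingHom.id_apply, ← Integrable.toL1_smul, Integrable.toL1_eq_toL1_iff]
        exact (hcongr (i _) ((i u).smul c) (Lp.coeFn_smul c u)).trans (hsmul c (i u)) }
  have hL₀ (u : ℝ →₁[unitMeasure] ℝ) : L₀ u =ᵐ[unitMeasure] P u := (hintg (i u)).coeFn_toL1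
  have hL₀n (u : ℝ →₁[unitMeasure] ℝ) : ‖L₀ u‖ ≤ 1 * ‖u‖ := by
    rw [one_mul, L1.norm_eq_integral_norm, L1.norm_eq_integral_norm]
    refine le_trans (integral_congr_ae ?_).le (hnorm (i u))
    filter_upwards [hL₀ u] with x hx
    rw [hx]
  refine ⟨L₀.mkContinuous 1 hL₀n, ⟨fun u => by simpa using hL₀n u, fun u s hs => ?_⟩,
    fun u f huf => ?_⟩
  · rw [← hset (i u) hs]
    exact integral_congr_ae (ae_restrict_of_ae (hL₀ u))
  · exact (hL₀ u).trans (hcongr (i u) ((i u).congr huf) huf)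

namespace IsTransferOperator

variable {T : PCT} {L : (ℝ →₁[unitMeasure] ℝ) →L[ℝ] (ℝ →₁[unitMeasure] ℝ)}

lemma hasSum_cumulative (hL : IsTransferOperator T L) (u : ℝ →₁[unitMeasure] ℝ) (x : ℝ) :
    HasSum (fun i => cumulative u (T.inv i x) - cumulative u (T.a i)) (cumulative (L u) x) := by
  have h := hasSum_integral_iUnion (μ := unitMeasure) (f := u) (fun i => measurableSet_Ioc)
    (T.disjoint_Ioc_inv x) (L1.integrable_coeFn u).integrableOn
  have h2 : cumulative (L u) x = ∫ t in ⋃ i, Ioc (T.a i) (T.inv i x), u t ∂unitMeasure := by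
    rw [cumulative, hL.setIntegral_eq u _ measurableSet_Iic,
      Measure.restrict_congr_set T.preimage_Iic_ae_eq]
  rw [h2]
  simpa only [← cumulative_sub_cumulative u (T.inv_mem _ x).1] using h

lemma integral_eq (hL : IsTransferOperator T L) (u : ℝ →₁[unitMeasure] ℝ) :
    ∫ x, L u x ∂unitMeasure = ∫ x, u x ∂unitMeasure := by
  simpa using hL.setIntegral_eq u univ MeasurableSet.univ

lemma monotoneOn_cumulative (hL : IsTransferOperator T L) {u : ℝ →₁[unitMeasure] ℝ}
    (hu : ∀ i, MonotoneOn (fun x => cumulative u (T.inv i x)) (Icc 0 1)) :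
    MonotoneOn (cumulative (L u)) (Icc 0 1) := fun x hx y hy hxy =>
  hasSum_le (fun i => sub_le_sub_right (hu i hx hy hxy) _)
    (hL.hasSum_cumulative u x) (hL.hasSum_cumulative u y)

lemma concaveOn_cumulative (hL : IsTransferOperator T L) {u : ℝ →₁[unitMeasure] ℝ}
    (hu : ∀ i, ConcaveOn ℝ (Icc 0 1) (fun x => cumulative u (T.inv i x))) :
    ConcaveOn ℝ (Icc 0 1) (cumulative (L u)) := by
  refine ⟨convex_Icc 0 1, fun x hx y hy c d hc hd hcd => ?_⟩
  refine hasSum_le (fun i => ?_) (((hL.hasSum_cumulative u x).const_smul c).add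
    ((hL.hasSum_cumulative u y).const_smul d)) (hL.hasSum_cumulative u _)
  have := (hu i).2 hx hy hc hd hcd
  simp only [smul_eq_mul] at this ⊢
  obtain rfl : d = 1 - c := by linarith
  linarith

end IsTransferOperator

lemma PCT.monotoneOn_comp_inv (T : PCT) (i : ℕ) {F : ℝ → ℝ}
    (hF : MonotoneOn F (Icc (T.a i) (T.b i))) :
    MonotoneOn (fun x => F (T.inv i x)) (Icc 0 1) := fun x _ y _ hxy =>
  hF (T.inv_mem i x) (T.inv_mem i y) (T.inv_mono i hxy)

lemma PCT.concaveOn_comp_inv (T : PCT) (i : ℕ) {F : ℝ → ℝ}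
    (hF : MonotoneOn F (Icc (T.a i) (T.b i))) (hF' : ConcaveOn ℝ (Icc (T.a i) (T.b i)) F) :
    ConcaveOn ℝ (Icc 0 1) (fun x => F (T.inv i x)) :=
  ⟨convex_Icc 0 1, fun x hx y hy _ _ hc hd hcd =>
    (hF'.2 (T.inv_mem i x) (T.inv_mem i y) hc hd hcd).trans
      (hF (hF'.1 (T.inv_mem i x) (T.inv_mem i y) hc hd hcd) (T.inv_mem i _)
        ((T.inv_concave i).2 hx hy hc hd hcd))⟩

lemma PCT.Icc_subset_unit (T : PCT) (i : ℕ) : Icc (T.a i) (T.b i) ⊆ Icc 0 1 :=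
  Icc_subset_Icc (T.a_nonneg i) (T.b_le_one i)

/-- Either the branches accumulate at the origin, or there is an expanding branch there. -/
lemma PCT.accumulating_or_expanding (T : PCT) :
    ((∀ i, 0 < T.a i) ∧ ∀ t > 0, ∃ i, T.a i < t) ∨ ∃ i, T.a i = 0 ∧ 1 < T.da i := by
  by_cases h : AccPt (0:ℝ) (𝓟 (range T.a))
  · rw [accPt_iff_frequently] at h
    have key (t : ℝ) (ht : 0 < t) : ∃ j, 0 < T.a j ∧ T.a j < t := by
      obtain ⟨_, ⟨h0, j, rfl⟩, hj⟩ := (h.and_eventually (Iio_mem_nhds ht)).exists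
      exact ⟨j, (T.a_nonneg j).lt_of_ne' h0, hj⟩
    refine Or.inl ⟨fun i => (T.a_nonneg i).lt_of_ne' fun hi => ?_, fun t ht => ?_⟩
    · obtain ⟨j, hj0, hj⟩ := key (T.b i) (hi ▸ T.lt i)
      exact hj.not_ge (T.b_le_a_of_a_lt (hi.symm ▸ hj0))
    · obtain ⟨j, -, hj⟩ := key t ht
      exact ⟨j, hj⟩
  · exact Or.inr (T.expand h)

lemma hasSum_ite_mem (f : ℕ → ℝ) (s : Finset ℕ) :
    HasSum (fun i => if i ∈ s then f i else 0) (∑ i ∈ s, f i) := by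
  have h : HasSum (fun i => if i ∈ s then f i else 0) (∑ i ∈ s, if i ∈ s then f i else 0) :=
    hasSum_sum_of_ne_finset_zero fun i hi => if_neg hi
  rwa [Finset.sum_congr rfl (g := f) fun i hi => if_pos hi] at h

lemma exists_finset_tsum_compl_lt {f : ℕ → ℝ} (hf : Summable f) {ε : ℝ} (hε : 0 < ε) :
    ∃ s : Finset ℕ, Summable (fun i => if i ∈ s then 0 else f i) ∧
      ∑' i, (if i ∈ s then 0 else f i) < ε := by
  obtain ⟨s, hs⟩ := (hf.hasSum.eventually (lt_mem_nhds (sub_lt_self _ hε))).exists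
  have h2 := hf.hasSum.sub (hasSum_ite_mem f s)
  have h3 : (fun i => f i - if i ∈ s then f i else 0) = fun i => if i ∈ s then 0 else f i := by
    ext i
    split_ifs <;> simp
  rw [h3] at h2
  exact ⟨s, h2.summable, by rw [h2.tsum_eq]; linarith⟩

/-- Finitely many branches away from the origin can be removed so that the remaining ones have
total contraction rate less than one. -/
lemma PCT.exists_finset_contraction (T : PCT) :
    ∃ s : Finset ℕ, (∀ i ∈ s, 0 < T.a i) ∧
      ∑' i, (if i ∈ s then 0 else 1 / T.da i) < 1 := by
  rcases T.accumulating_or_expanding with ⟨h, -⟩ | ⟨j, hj, hj1⟩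
  · obtain ⟨s, -, hs⟩ := exists_finset_tsum_compl_lt T.sum_inv one_pos
    exact ⟨s, fun i _ => h i, hs⟩
  · obtain ⟨s, hs, hs1⟩ := exists_finset_tsum_compl_lt T.sum_inv
      (sub_pos.2 ((div_lt_one (T.da_pos j)).2 hj1))
    refine ⟨s.erase j, fun i hi => (T.a_nonneg i).lt_of_ne' fun hi0 =>
      Finset.ne_of_mem_erase hi (T.a_injective (hi0.trans hj.symm)), ?_⟩
    have h1 := hs.hasSum.add (hasSum_ite_eq j (1 / T.da j))
    have h2 (i : ℕ) : 0 ≤ if i ∈ s.erase j then 0 else 1 / T.da i := by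
      have := (one_div_pos.2 (T.da_pos i)).le
      split_ifs <;> first | exact le_rfl | exact this
    have h3 (i : ℕ) : (if i ∈ s.erase j then 0 else 1 / T.da i) ≤
        (if i ∈ s then 0 else 1 / T.da i) + if i = j then 1 / T.da j else 0 := by
      have := (one_div_pos.2 (T.da_pos i)).le
      by_cases hij : i = j
      · subst hij
        by_cases his : i ∈ s <;> simp [his, T.da_pos i |>.le]
      · simp [hij]
    have h4 := hasSum_le h3 (h1.summable.of_nonneg_of_le h2 h3).hasSum h1
    linarith

lemma IsTransferOperator.exists_contraction (T : PCT) : ∃ α D : ℝ, 0 ≤ α ∧ α < 1 ∧ 0 ≤ D ∧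
    ∀ {L : (ℝ →₁[unitMeasure] ℝ) →L[ℝ] (ℝ →₁[unitMeasure] ℝ)}, IsTransferOperator T L →
    ∀ {K : ℝ} {u : ℝ →₁[unitMeasure] ℝ}, IsConcaveCdf K (cumulative u) →
      IsConcaveCdf (α * K + D) (cumulative (L u)) := by
  obtain ⟨s, hs, hs1⟩ := T.exists_finset_contraction
  have hsum : Summable fun i => (if i ∈ s then 0 else 1 / T.da i) := by
    refine Summable.of_nonneg_of_le (fun i => ?_) (fun i => ?_) T.sum_inv
    all_goals
      have := (one_div_pos.2 (T.da_pos i)).le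
      split_ifs <;> first | exact le_rfl | exact this
  refine ⟨∑' i, (if i ∈ s then 0 else 1 / T.da i), ∑ i ∈ s, 1 / (T.a i * T.da i), ?_, hs1, ?_,
    fun {L} hL {K u} hu => ?_⟩
  · refine tsum_nonneg fun i => ?_
    have := (one_div_pos.2 (T.da_pos i)).le
    split_ifs <;> first | exact le_rfl | exact this
  · refine Finset.sum_nonneg fun i hi => ?_
    have := T.da_pos i
    have := hs i hi
    positivity
  · refine ⟨hL.monotoneOn_cumulative fun i => T.monotoneOn_comp_inv i
      (hu.mono.mono (T.Icc_subset_unit i)), hL.concaveOn_cumulative fun i =>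
      T.concaveOn_comp_inv i (hu.mono.mono (T.Icc_subset_unit i))
        (hu.conc.subset (T.Icc_subset_unit i) (convex_Icc _ _)), cumulative_zero_right _, ?_,
      fun x hx => ?_⟩
    · rw [cumulative_one_right, hL.integral_eq, ← cumulative_one_right, hu.one]
    have hD := hasSum_ite_mem (fun i => 1 / (T.a i * T.da i)) s
    refine hasSum_le (fun i => ?_) (hL.hasSum_cumulative u x)
      (((hsum.hasSum.mul_right K).add hD).mul_right x)
    have h1 := T.inv_sub_le i hx.1
    have hda := T.da_pos i
    split_ifs with his
    · have ha := hs i his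
      have h2 := hu.conc.sub_mul_le hu.zero ha.le (T.inv_mem i x).1 (T.inv_mem_unit i x).2
      have h3 := hu.le_one (T.a_mem_unit i)
      have h4 : cumulative u (T.a i) * (T.inv i x - T.a i) ≤ x / T.da i :=
        (mul_le_of_le_one_left (sub_nonneg.2 (T.inv_mem i x).1) h3).trans h1
      rw [zero_mul, zero_add, one_div, inv_mul_eq_div, mul_comm (T.a i), ← div_div, le_div_iff₀ ha]
      exact h2.trans h4
    · have h2 := hu.sub_le (T.a_nonneg i) (T.inv_mem i x).1 (T.inv_mem_unit i x).2
      have hK := zero_le_one.trans hu.one_le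
      calc _ ≤ K * (T.inv i x - T.a i) := h2
        _ ≤ K * (x / T.da i) := by gcongr
        _ = _ := by ring

lemma IsConcaveCdf.of_le {K K' : ℝ} {F : ℝ → ℝ} (hF : IsConcaveCdf K F) (h : K ≤ K') :
    IsConcaveCdf K' F :=
  ⟨hF.mono, hF.conc, hF.zero, hF.one, fun x hx =>
    (hF.le x hx).trans (mul_le_mul_of_nonneg_right h hx.1)⟩

/-- The densities with concave distribution function bounded by `K x` are uniformly bounded below
on `[0,t]` after some number of applications of `L`. -/
def SpreadsTo (L : (ℝ →₁[unitMeasure] ℝ) →L[ℝ] (ℝ →₁[unitMeasure] ℝ)) (K t : ℝ) : Prop :=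
  ∃ (N : ℕ) (δ : ℝ), 0 < δ ∧ ∀ u, IsConcaveCdf K (cumulative u) →
    ∀ x y, 0 ≤ x → x ≤ y → y ≤ t → y ≤ 1 →
      δ * (y - x) ≤ cumulative ((L ^ N) u) y - cumulative ((L ^ N) u) x

section Spread

variable {T : PCT} {L : (ℝ →₁[unitMeasure] ℝ) →L[ℝ] (ℝ →₁[unitMeasure] ℝ)} {K t : ℝ}

lemma pow_isConcaveCdf
    (hLK : ∀ u, IsConcaveCdf K (cumulative u) → IsConcaveCdf K (cumulative (L u))) (n : ℕ)
    {u : ℝ →₁[unitMeasure] ℝ} (hu : IsConcaveCdf K (cumulative u)) :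
    IsConcaveCdf K (cumulative ((L ^ n) u)) := by
  induction n with
  | zero => exact hu
  | succ n ih =>
    rw [pow_succ']
    exact hLK _ ih

lemma SpreadsTo.of_le {s : ℝ} (h : SpreadsTo L K t) (hst : s ≤ t) : SpreadsTo L K s := by
  obtain ⟨N, δ, hδ, h⟩ := h
  exact ⟨N, δ, hδ, fun u hu x y hx hxy hy => h u hu x y hx hxy (hy.trans hst)⟩

lemma spreadsTo_inv_two_mul (L : (ℝ →₁[unitMeasure] ℝ) →L[ℝ] (ℝ →₁[unitMeasure] ℝ))
    (hK : 0 < K) : SpreadsTo L K (1 / (2 * K)) := by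
  refine ⟨0, 1 / 2, by norm_num, fun u hu x y hx hxy hy hy1 => ?_⟩
  rw [pow_zero, one_apply_eq_self]
  refine le_trans ?_ (hu.conc.mul_le_sub hu.mono hx hxy hy1)
  have h1 := hu.le y ⟨hx.trans hxy, hy1⟩
  rw [le_div_iff₀ (by positivity)] at hy
  rw [hu.one]
  exact mul_le_mul_of_nonneg_right (by linarith) (sub_nonneg.2 hxy)

lemma IsTransferOperator.sub_le_sub (hL : IsTransferOperator T L) {u : ℝ →₁[unitMeasure] ℝ}
    (hu : MonotoneOn (cumulative u) (Icc 0 1)) (i : ℕ) {x y : ℝ} (hxy : x ≤ y) :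
    cumulative u (T.inv i y) - cumulative u (T.inv i x) ≤
      cumulative (L u) y - cumulative (L u) x := by
  have h := le_hasSum ((hL.hasSum_cumulative u y).sub (hL.hasSum_cumulative u x)) i fun j _ => by
    have := hu (T.inv_mem_unit j x) (T.inv_mem_unit j y) (T.inv_mono j hxy)
    linarith
  linarith

lemma SpreadsTo.expand (hL : IsTransferOperator T L)
    (hLK : ∀ u, IsConcaveCdf K (cumulative u) → IsConcaveCdf K (cumulative (L u)))
    {i : ℕ} (hi : T.a i = 0) (htb : t < T.b i) (h : SpreadsTo L K t) :
    SpreadsTo L K (T.da i * t) := by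
  obtain ⟨N, δ, hδ, h⟩ := h
  refine ⟨N + 1, δ * (T.b i - t), mul_pos hδ (sub_pos.2 htb),
    fun u hu x y hx hxy hy hy1 => ?_⟩
  rw [pow_succ', mul_apply_eq_comp]
  have hyt : T.inv i y ≤ t := by
    have := T.inv_sub_le i (hx.trans hxy)
    rw [hi, sub_zero] at this
    exact this.trans ((div_le_iff₀' (T.da_pos i)).2 hy)
  have h1 := (T.inv_concave i).mul_le_sub ((T.inv_mono i).monotoneOn _) hx hxy hy1
  rw [T.inv_one] at h1
  calc δ * (T.b i - t) * (y - x) ≤ δ * ((T.b i - T.inv i y) * (y - x)) := by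
        rw [mul_assoc]
        have := sub_nonneg.2 hxy
        gcongr
    _ ≤ δ * (T.inv i y - T.inv i x) := by gcongr
    _ ≤ _ := h u hu _ _ (T.inv_mem_unit i x).1 (T.inv_mono i hxy) hyt (T.inv_mem_unit i y).2
    _ ≤ _ := hL.sub_le_sub (pow_isConcaveCdf hLK N hu).mono i hxy

lemma exists_spreadsTo_branch (hL : IsTransferOperator T L) (hK : 0 < K)
    (hLK : ∀ u, IsConcaveCdf K (cumulative u) → IsConcaveCdf K (cumulative (L u))) :
    ∃ i, SpreadsTo L K (T.b i) := by
  have h0 := spreadsTo_inv_two_mul L hK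
  have ht0 : 0 < 1 / (2 * K) := by positivity
  rcases T.accumulating_or_expanding with ⟨h, hacc⟩ | ⟨i, hi, hi1⟩
  · obtain ⟨j, hj⟩ := hacc _ ht0
    obtain ⟨k, hk⟩ := hacc _ (h j)
    exact ⟨k, h0.of_le ((T.b_le_a_of_a_lt hk).trans hj.le)⟩
  · refine ⟨i, by_contra fun hb => ?_⟩
    have hlt {t : ℝ} (ht : SpreadsTo L K t) : t < T.b i := by
      by_contra! h
      exact hb (ht.of_le h)
    have hn (n : ℕ) : SpreadsTo L K (T.da i ^ n * (1 / (2 * K))) := by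
      induction n with
      | zero => simpa using h0
      | succ n ih =>
        rw [pow_succ', mul_assoc]
        exact ih.expand hL hLK hi (hlt ih)
    obtain ⟨n, hn'⟩ := pow_unbounded_of_one_lt (2 * K) hi1
    have h1 := (hlt (hn n)).trans_le (T.b_le_one i)
    rw [mul_one_div, div_lt_one (by positivity)] at h1
    exact lt_asymm h1 hn'

end Spread

/-- The indicator of a branch interval, as an element of `L¹[0,1]`. -/
lemma PCT.exists_branch_indicator (T : PCT) (i : ℕ) : ∃ χ : ℝ →₁[unitMeasure] ℝ,
    ∫ x, χ x ∂unitMeasure = T.b i - T.a i ∧ MonotoneOn (cumulative χ) (Icc 0 1) ∧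
    ∀ j, ∃ e : ℝ, (e = 0 ∨ j = i ∧ e = 1) ∧ ∀ x ∈ Icc (T.a j) (T.b j),
      cumulative χ x = cumulative χ (T.a j) + e * (x - T.a j) := by
  set χ : ℝ →₁[unitMeasure] ℝ :=
    indicatorConstLp 1 (measurableSet_Ioc (a := T.a i) (b := T.b i)) (measure_ne_top _ _) 1
  have hχ : χ =ᵐ[unitMeasure] (Ioc (T.a i) (T.b i)).indicator fun _ => (1:ℝ) :=
    indicatorConstLp_coeFn
  refine ⟨χ, ?_, fun x hx y hy hxy => ?_, fun j => ?_⟩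
  · rw [integral_congr_ae hχ, integral_indicator_const _ measurableSet_Ioc,
      measureReal_restrict_apply measurableSet_Ioc, inter_eq_self_of_subset_left
      (Ioc_subset_Icc_self.trans (T.Icc_subset_unit i)), Real.volume_real_Ioc_of_le (T.lt i).le,
      smul_eq_mul, mul_one]
  · have := (cumulative_sub_mem_Icc (c := 0) (d := 1) hχ hx.1 hxy hy.2 fun t _ => by
      by_cases ht : t ∈ Ioc (T.a i) (T.b i) <;> simp [ht]).1
    linarith
  · have key (e : ℝ) (he : ∀ t ∈ Ioc (T.a j) (T.b j),
        (Ioc (T.a i) (T.b i)).indicator (fun _ => (1:ℝ)) t = e) (x : ℝ)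
        (hx : x ∈ Icc (T.a j) (T.b j)) :
        cumulative χ x = cumulative χ (T.a j) + e * (x - T.a j) := by
      have := cumulative_sub_mem_Icc (c := e) (d := e) hχ (T.a_nonneg j) hx.1
        (hx.2.trans (T.b_le_one j)) fun t ht => by
          rw [he t ⟨ht.1, ht.2.trans hx.2⟩]
          exact ⟨le_rfl, le_rfl⟩
      rw [Icc_self, mem_singleton_iff] at this
      linarith
    by_cases hij : j = i
    · subst hij
      exact ⟨1, Or.inr ⟨rfl, rfl⟩, key 1 fun t ht => indicator_of_mem ht _⟩
    · refine ⟨0, Or.inl rfl, key 0 fun t ht => indicator_of_notMem (fun ht' => ?_) _⟩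
      have := T.disjoint_Ioc_inv 1 hij
      simp only [Function.onFun, T.inv_one] at this
      exact disjoint_left.1 this ht ht'

/-- A Doeblin type minorization for the transfer operator. -/
lemma IsTransferOperator.exists_minorization {T : PCT}
    {L : (ℝ →₁[unitMeasure] ℝ) →L[ℝ] (ℝ →₁[unitMeasure] ℝ)} (hL : IsTransferOperator T L)
    {α D K : ℝ} (hα : 0 ≤ α) (hα1 : α < 1) (hK : 0 < K) (hD : 2 * D ≤ (1 - α) * K)
    (hc : ∀ {K : ℝ} {u : ℝ →₁[unitMeasure] ℝ}, IsConcaveCdf K (cumulative u) →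
      IsConcaveCdf (α * K + D) (cumulative (L u))) :
    ∃ (M : ℕ) (η : ℝ) (ψ : ℝ →₁[unitMeasure] ℝ), 1 ≤ M ∧ 0 < η ∧ η < 1 ∧
      ∀ u, IsConcaveCdf K (cumulative u) → ∃ v, IsConcaveCdf K (cumulative v) ∧
        (L ^ M) u = ψ + (1 - η) • v := by
  have hLK (u) (hu : IsConcaveCdf K (cumulative u)) : IsConcaveCdf K (cumulative (L u)) :=
    (hc hu).of_le (by nlinarith)
  obtain ⟨i, N, δ₀, hδ₀, hN⟩ := exists_spreadsTo_branch hL hK hLK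
  obtain ⟨χ, hχ1, hχm, hχ⟩ := T.exists_branch_indicator i
  set δ := min δ₀ ((1 - α) / 2)
  have hδ : 0 < δ := lt_min hδ₀ (by linarith)
  set η := δ * (T.b i - T.a i) with hη
  have hab := T.lt i
  have hη0 : 0 < η := mul_pos hδ (sub_pos.2 hab)
  have hη1 : η ≤ (1 - α) / 2 := by
    have h1 := T.b_le_one i
    have h2 := T.a_nonneg i
    exact (mul_le_of_le_one_right hδ.le (by linarith)).trans (min_le_right _ _)
  have hr : 0 < 1 - η := by linarith
  refine ⟨N + 2, η, δ • L (L χ), by omega, hη0, by linarith, fun u hu => ?_⟩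
  set v := (L ^ N) u with hv
  have hvK : IsConcaveCdf K (cumulative v) := pow_isConcaveCdf hLK N hu
  set w := v - δ • χ with hw
  have hwF (x : ℝ) : cumulative w x = cumulative v x - δ * cumulative χ x := by
    rw [hw, cumulative_sub, cumulative_smul]
  have hwm (j : ℕ) : MonotoneOn (cumulative w) (Icc (T.a j) (T.b j)) := by
    intro x hx y hy hxy
    obtain ⟨e, he, hform⟩ := hχ j
    rw [hwF, hwF, hform x hx, hform y hy]
    rcases he with rfl | ⟨rfl, rfl⟩
    · have := hvK.mono (T.Icc_subset_unit j hx) (T.Icc_subset_unit j hy) hxy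
      linarith
    · have h1 := hN u hu x y (T.Icc_subset_unit j hx).1 hxy hy.2 (T.Icc_subset_unit j hy).2
      have h2 : δ * (y - x) ≤ δ₀ * (y - x) :=
        mul_le_mul_of_nonneg_right (min_le_left _ _) (sub_nonneg.2 hxy)
      linarith
  have hwc (j : ℕ) : ConcaveOn ℝ (Icc (T.a j) (T.b j)) (cumulative w) := by
    refine ⟨convex_Icc _ _, fun x hx y hy c d hc hd hcd => ?_⟩
    obtain ⟨e, -, hform⟩ := hχ j
    have h1 := hvK.conc.2 (T.Icc_subset_unit j hx) (T.Icc_subset_unit j hy) hc hd hcd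
    have h2 := convex_Icc (T.a j) (T.b j) hx hy hc hd hcd
    rw [hwF, hwF, hwF, hform x hx, hform y hy, hform _ h2]
    simp only [smul_eq_mul] at h1 ⊢
    obtain rfl : d = 1 - c := by linarith
    linarith
  have hLχ (x : ℝ) (hx : x ∈ Icc (0:ℝ) 1) : 0 ≤ cumulative (L χ) x := by
    have := hL.monotoneOn_cumulative (fun j => T.monotoneOn_comp_inv j
      (hχm.mono (T.Icc_subset_unit j))) (by simp) hx hx.1
    rwa [cumulative_zero_right] at this
  have hLw (x : ℝ) : cumulative (L w) x = cumulative (L v) x - δ * cumulative (L χ) x := by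
    rw [hw, map_sub, map_smul, cumulative_sub, cumulative_smul]
  have hLvK := hLK v hvK
  have hmain : IsConcaveCdf ((1 - η)⁻¹ * K) (cumulative ((1 - η)⁻¹ • L w)) := by
    have hr' : 0 ≤ (1 - η)⁻¹ := (inv_pos.2 hr).le
    have hfun : cumulative ((1 - η)⁻¹ • L w) = (1 - η)⁻¹ • cumulative (L w) := by
      ext x
      rw [cumulative_smul, Pi.smul_apply, smul_eq_mul]
    rw [hfun]
    refine ⟨fun x hx y hy hxy => ?_, (hL.concaveOn_cumulative fun j => T.concaveOn_comp_inv j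
      (hwm j) (hwc j)).smul hr', ?_, ?_, fun x hx => ?_⟩
    · exact mul_le_mul_of_nonneg_left (hL.monotoneOn_cumulative (fun j =>
        T.monotoneOn_comp_inv j (hwm j)) hx hy hxy) hr'
    · simp [cumulative_zero_right]
    · rw [Pi.smul_apply, hLw, hLvK.one, cumulative_one_right, hL.integral_eq, hχ1, ← hη,
        smul_eq_mul, inv_mul_cancel₀ hr.ne']
    · rw [Pi.smul_apply, smul_eq_mul, mul_assoc]
      refine mul_le_mul_of_nonneg_left ?_ hr'
      rw [hLw]
      have h1 := mul_nonneg hδ.le (hLχ x hx)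
      have h2 := hLvK.le x hx
      linarith
  refine ⟨L ((1 - η)⁻¹ • L w), (hc hmain).of_le ?_, ?_⟩
  · have h1 : α * (1 - η)⁻¹ ≤ (1 + α) / 2 := by
      rw [← div_eq_mul_inv, div_le_iff₀ hr]
      nlinarith [sq_nonneg (1 - α)]
    nlinarith
  · rw [map_smul, smul_smul, mul_inv_cancel₀ hr.ne', one_smul, hw, map_sub, map_sub, map_smul,
      map_smul, add_sub_cancel, add_comm N 2, pow_add, mul_apply_eq_comp, ← hv, sq,
      mul_apply_eq_comp]

section Convergence

variable {L : (ℝ →₁[unitMeasure] ℝ) →L[ℝ] (ℝ →₁[unitMeasure] ℝ)} {K r : ℝ} {M : ℕ}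

lemma exists_pow_sub_pow_eq
    (hLK : ∀ u, IsConcaveCdf K (cumulative u) → IsConcaveCdf K (cumulative (L u)))
    {ψ : ℝ →₁[unitMeasure] ℝ} (hmin : ∀ u, IsConcaveCdf K (cumulative u) →
      ∃ v, IsConcaveCdf K (cumulative v) ∧ (L ^ M) u = ψ + r • v)
    {u v : ℝ →₁[unitMeasure] ℝ} (hu : IsConcaveCdf K (cumulative u))
    (hv : IsConcaveCdf K (cumulative v)) (n : ℕ) :
    ∃ u' v', IsConcaveCdf K (cumulative u') ∧ IsConcaveCdf K (cumulative v') ∧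
      (L ^ n) u - (L ^ n) v = r ^ (n / M) • (u' - v') := by
  have key (k : ℕ) : ∃ u' v', IsConcaveCdf K (cumulative u') ∧ IsConcaveCdf K (cumulative v') ∧
      (L ^ (M * k)) u - (L ^ (M * k)) v = r ^ k • (u' - v') := by
    induction k with
    | zero => exact ⟨u, v, hu, hv, by simp⟩
    | succ k ih =>
      obtain ⟨u', v', hu', hv', h⟩ := ih
      obtain ⟨u'', hu'', h1⟩ := hmin u' hu'
      obtain ⟨v'', hv'', h2⟩ := hmin v' hv'
      refine ⟨u'', v'', hu'', hv'', ?_⟩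
      rw [Nat.mul_succ, add_comm, pow_add, mul_apply_eq_comp, mul_apply_eq_comp, ← map_sub, h,
        map_smul, map_sub, h1, h2, add_sub_add_left_eq_sub, ← smul_sub, smul_smul, pow_succ]
  obtain ⟨u', v', hu', hv', h⟩ := key (n / M)
  refine ⟨_, _, pow_isConcaveCdf hLK (n % M) hu', pow_isConcaveCdf hLK (n % M) hv', ?_⟩
  rw [← map_sub (L ^ (n % M)), ← map_smul, ← h, map_sub, ← mul_apply_eq_comp,
    ← mul_apply_eq_comp, ← pow_add, Nat.mod_add_div]

lemma norm_pow_sub_pow_le (hr : 0 ≤ r)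
    (hLK : ∀ u, IsConcaveCdf K (cumulative u) → IsConcaveCdf K (cumulative (L u)))
    {ψ : ℝ →₁[unitMeasure] ℝ} (hmin : ∀ u, IsConcaveCdf K (cumulative u) →
      ∃ v, IsConcaveCdf K (cumulative v) ∧ (L ^ M) u = ψ + r • v)
    {u v : ℝ →₁[unitMeasure] ℝ} (hu : IsConcaveCdf K (cumulative u))
    (hv : IsConcaveCdf K (cumulative v)) (n : ℕ) :
    ‖(L ^ n) u - (L ^ n) v‖ ≤ 2 * r ^ (n / M) := by
  obtain ⟨u', v', hu', hv', h⟩ := exists_pow_sub_pow_eq hLK hmin hu hv n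
  rw [h, norm_smul, Real.norm_of_nonneg (by positivity), mul_comm]
  gcongr
  linarith [norm_sub_le u' v', hu'.norm_le, hv'.norm_le]

end Convergence

lemma integral_smul_sub_smul {K m₁ m₂ : ℝ} {g₁ g₂ : ℝ →₁[unitMeasure] ℝ}
    (h₁ : IsConcaveCdf K (cumulative g₁)) (h₂ : IsConcaveCdf K (cumulative g₂)) :
    ∫ x, (m₁ • g₁ - m₂ • g₂ : ℝ →₁[unitMeasure] ℝ) x ∂unitMeasure = m₁ - m₂ := by
  rw [← cumulative_one_right, cumulative_sub, cumulative_smul, cumulative_smul, h₁.one, h₂.one,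
    mul_one, mul_one]

/-- Differences of scaled monotone densities are dense in `L¹[0,1]`. -/
lemma exists_norm_sub_lt {K : ℝ} (hK : 2 ≤ K) (u : ℝ →₁[unitMeasure] ℝ) {ε : ℝ} (hε : 0 < ε) :
    ∃ (m₁ m₂ : ℝ) (g₁ g₂ : ℝ →₁[unitMeasure] ℝ), 0 ≤ m₁ ∧ 0 ≤ m₂ ∧
      IsConcaveCdf K (cumulative g₁) ∧ IsConcaveCdf K (cumulative g₂) ∧
      ‖u - (m₁ • g₁ - m₂ • g₂)‖ < ε := by
  obtain ⟨w, ⟨f, hwf, hfs, hfd⟩, hw⟩ := Metric.mem_closure_iff.1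
    (Lp.dense_hasCompactSupport_contDiff (μ := unitMeasure) (F := ℝ) (p := 1)
      ENNReal.one_ne_top u) ε hε
  obtain ⟨C, hC⟩ := hfd.lipschitzWith_of_hasCompactSupport hfs (by simp)
  have hbv : BoundedVariationOn f (Icc 0 1) :=
    hC.comp_boundedVariationOn (BoundedVariationOn.id_Icc 0 1)
  have hfi : Integrable f unitMeasure := (L1.integrable_coeFn w).congr hwf
  obtain ⟨m₁, m₂, g₁, g₂, hm₁, hm₂, hg₁, hg₂, hf⟩ := exists_decomposition hK hfi hbv
  refine ⟨m₁, m₂, g₁, g₂, hm₁.1, hm₂.1, hg₁, hg₂, ?_⟩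
  have : w = hfi.toL1 f := Lp.ext (hwf.trans hfi.coeFn_toL1.symm)
  rwa [← hf, ← this, ← dist_eq_norm]

lemma IsTransferOperator.norm_pow_le {T : PCT}
    {L : (ℝ →₁[unitMeasure] ℝ) →L[ℝ] (ℝ →₁[unitMeasure] ℝ)} (hL : IsTransferOperator T L) (n : ℕ)
    (u : ℝ →₁[unitMeasure] ℝ) : ‖(L ^ n) u‖ ≤ ‖u‖ := by
  induction n with
  | zero => simp
  | succ n ih =>
    rw [pow_succ', mul_apply_eq_comp]
    exact (hL.norm_le _).trans ih

lemma pow_apply_eq_self {L : (ℝ →₁[unitMeasure] ℝ) →L[ℝ] (ℝ →₁[unitMeasure] ℝ)}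
    {u : ℝ →₁[unitMeasure] ℝ} (hu : L u = u) (n : ℕ) : (L ^ n) u = u := by
  induction n with
  | zero => simp
  | succ n ih => rw [pow_succ', mul_apply_eq_comp, ih, hu]

/-- The invariant density is nonincreasing. -/
lemma IsTransferOperator.isConcaveCdf_of_fixed {T : PCT}
    {L : (ℝ →₁[unitMeasure] ℝ) →L[ℝ] (ℝ →₁[unitMeasure] ℝ)} (hL : IsTransferOperator T L)
    {K r : ℝ} {M : ℕ} (hM : 1 ≤ M) (hK : 2 ≤ K) (hr : 0 ≤ r) (hr1 : r < 1)
    (hLK : ∀ u, IsConcaveCdf K (cumulative u) → IsConcaveCdf K (cumulative (L u)))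
    {ψ : ℝ →₁[unitMeasure] ℝ} (hmin : ∀ u, IsConcaveCdf K (cumulative u) →
      ∃ v, IsConcaveCdf K (cumulative v) ∧ (L ^ M) u = ψ + r • v)
    {h : ℝ →₁[unitMeasure] ℝ} (hfix : L h = h) (h1 : ∫ x, h x ∂unitMeasure = 1) :
    IsConcaveCdf K (cumulative h) := by
  have he := isConcaveCdf_unitDensity (K := K) (by linarith)
  suffices h ∈ closure {u : ℝ →₁[unitMeasure] ℝ | IsConcaveCdf K (cumulative u)} by
    rwa [(isClosed_isConcaveCdf K).closure_eq] at this
  refine Metric.mem_closure_iff.2 fun ε hε => ?_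
  obtain ⟨m₁, m₂, g₁, g₂, hm₁, hm₂, hg₁, hg₂, hg⟩ :=
    exists_norm_sub_lt hK h (show 0 < ε / 3 by positivity)
  obtain ⟨k, hk⟩ := exists_pow_lt_of_lt_one
    (show 0 < ε / 3 / (2 * (m₁ + m₂) + 1) by positivity) hr1
  rw [lt_div_iff₀ (by positivity)] at hk
  refine ⟨(L ^ (M * k)) unitDensity, pow_isConcaveCdf hLK _ he, ?_⟩
  have hd₁ := norm_pow_sub_pow_le hr hLK hmin hg₁ he (M * k)
  have hd₂ := norm_pow_sub_pow_le hr hLK hmin hg₂ he (M * k)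
  rw [Nat.mul_div_cancel_left _ hM] at hd₁ hd₂
  have hm : |m₁ - m₂ - 1| < ε / 3 := by
    refine lt_of_le_of_lt ?_ hg
    rw [← integral_smul_sub_smul (m₁ := m₁) (m₂ := m₂) hg₁ hg₂, ← h1, ← L1.integral_eq_integral,
      ← L1.integral_eq_integral, ← L1.integral_sub, ← Real.norm_eq_abs, norm_sub_rev h]
    exact L1.norm_integral_le _
  set n := M * k
  have hsplit : h - (L ^ n) unitDensity = (L ^ n) (h - (m₁ • g₁ - m₂ • g₂)) +
      (m₁ • ((L ^ n) g₁ - (L ^ n) unitDensity) - m₂ • ((L ^ n) g₂ - (L ^ n) unitDensity)) +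
      (m₁ - m₂ - 1) • (L ^ n) unitDensity := by
    rw [map_sub, map_sub, map_smul, map_smul, pow_apply_eq_self hfix]
    module
  rw [dist_eq_norm, hsplit]
  have hn1 : ‖(L ^ n) (h - (m₁ • g₁ - m₂ • g₂))‖ < ε / 3 := (hL.norm_pow_le n _).trans_lt hg
  have hn2 : ‖m₁ • ((L ^ n) g₁ - (L ^ n) unitDensity) -
      m₂ • ((L ^ n) g₂ - (L ^ n) unitDensity)‖ ≤ ε / 3 := by
    refine (norm_sub_le _ _).trans ?_
    rw [norm_smul, norm_smul, Real.norm_of_nonneg hm₁, Real.norm_of_nonneg hm₂]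
    have := mul_le_mul_of_nonneg_left hd₁ hm₁
    have := mul_le_mul_of_nonneg_left hd₂ hm₂
    have := pow_nonneg hr k
    nlinarith
  have hn3 : ‖(m₁ - m₂ - 1) • (L ^ n) unitDensity‖ ≤ ε / 3 := by
    rw [norm_smul, Real.norm_eq_abs]
    have := (pow_isConcaveCdf hLK n he).norm_le
    exact (mul_le_of_le_one_right (abs_nonneg _) this).trans hm.le
  refine (norm_add_le _ _).trans_lt ?_
  linarith [norm_add_le ((L ^ n) (h - (m₁ • g₁ - m₂ • g₂)))
    (m₁ • ((L ^ n) g₁ - (L ^ n) unitDensity) - m₂ • ((L ^ n) g₂ - (L ^ n) unitDensity))]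

lemma eVariationOn_sub_le_of_antitone {A B : ℝ → ℝ} (hA : Antitone A) (hB : Antitone B) {R : ℝ}
    (hAR : ∀ x, A x ∈ Icc 0 R) (hBR : ∀ x, B x ∈ Icc 0 R) (s : Set ℝ) :
    eVariationOn (fun x => A x - B x) s ≤ ENNReal.ofReal (2 * R) := by
  refine iSup_le fun ⟨n, u, hu, _⟩ => ?_
  calc ∑ i ∈ Finset.range n, edist (A (u (i + 1)) - B (u (i + 1))) (A (u i) - B (u i))
      ≤ ∑ i ∈ Finset.range n,
          ENNReal.ofReal ((A (u i) + B (u i)) - (A (u (i + 1)) + B (u (i + 1)))) := by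
        refine Finset.sum_le_sum fun i _ => ?_
        rw [edist_dist, Real.dist_eq]
        have h1 := hA (hu i.le_succ)
        have h2 := hB (hu i.le_succ)
        refine ENNReal.ofReal_le_ofReal (abs_le.2 ⟨?_, ?_⟩) <;>
        · simp only [Nat.succ_eq_add_one] at h1 h2
          linarith
    _ = ENNReal.ofReal (∑ i ∈ Finset.range n,
          ((A (u i) + B (u i)) - (A (u (i + 1)) + B (u (i + 1))))) := by
        refine (ENNReal.ofReal_sum_of_nonneg fun i _ => ?_).symm
        exact sub_nonneg.2 (add_le_add (hA (hu i.le_succ)) (hB (hu i.le_succ)))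
    _ ≤ ENNReal.ofReal (2 * R) := by
        rw [Finset.sum_range_sub' (fun i => A (u i) + B (u i))]
        refine ENNReal.ofReal_le_ofReal ?_
        linarith [(hAR (u 0)).2, (hBR (u 0)).2, (hAR (u n)).1, (hBR (u n)).1]

lemma pow_div_le_mul_pow {r : ℝ} (hr : 0 < r) (hr1 : r < 1) {M : ℕ} (hM : 1 ≤ M) :
    ∃ q : ℝ, 0 < q ∧ q < 1 ∧ ∀ n : ℕ, r ^ (n / M) ≤ r⁻¹ * q ^ n := by
  have hM' : (0:ℝ) < M := by exact_mod_cast hM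
  have hq : 0 < r ^ (M:ℝ)⁻¹ := Real.rpow_pos_of_pos hr _
  have hq1 : r ^ (M:ℝ)⁻¹ < 1 := Real.rpow_lt_one hr.le hr1 (by positivity)
  have hqM : (r ^ (M:ℝ)⁻¹) ^ M = r := Real.rpow_inv_natCast_pow hr.le (by omega)
  refine ⟨_, hq, hq1, fun n => ?_⟩
  rw [inv_mul_eq_div, le_div_iff₀ hr]
  calc r ^ (n / M) * r ≤ r ^ (n / M) * (r ^ (M:ℝ)⁻¹) ^ (n % M) := by
        refine mul_le_mul_of_nonneg_left ?_ (by positivity)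
        conv_lhs => rw [← hqM]
        exact pow_le_pow_of_le_one hq.le hq1.le (Nat.mod_lt _ hM).le
    _ = (r ^ (M:ℝ)⁻¹) ^ n := by
        conv_lhs => rw [← hqM]
        rw [← pow_mul, hqM, ← pow_add, Nat.div_add_mod]

/-- On `L¹`, the deviation from equilibrium has a version which is a difference of small
nonincreasing functions. -/
lemma exists_antitone_sub_version {L : (ℝ →₁[unitMeasure] ℝ) →L[ℝ] (ℝ →₁[unitMeasure] ℝ)}
    {K r : ℝ} {M : ℕ} (hr : 0 ≤ r)
    (hLK : ∀ u, IsConcaveCdf K (cumulative u) → IsConcaveCdf K (cumulative (L u)))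
    {ψ : ℝ →₁[unitMeasure] ℝ} (hmin : ∀ u, IsConcaveCdf K (cumulative u) →
      ∃ v, IsConcaveCdf K (cumulative v) ∧ (L ^ M) u = ψ + r • v)
    {h g₁ g₂ : ℝ →₁[unitMeasure] ℝ} (hfix : L h = h) (hh : IsConcaveCdf K (cumulative h))
    (hg₁ : IsConcaveCdf K (cumulative g₁)) (hg₂ : IsConcaveCdf K (cumulative g₂))
    {m₁ m₂ C : ℝ} (hm₁ : m₁ ∈ Icc 0 C) (hm₂ : m₂ ∈ Icc 0 C) (n : ℕ) :
    ∃ A B : ℝ → ℝ, Antitone A ∧ Antitone B ∧ (∀ x, A x ∈ Icc 0 (r ^ (n / M) * (2 * C * K))) ∧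
      (∀ x, B x ∈ Icc 0 (r ^ (n / M) * (2 * C * K))) ∧
      (fun x => A x - B x) =ᵐ[unitMeasure]
        ((L ^ n) (m₁ • g₁ - m₂ • g₂) - (m₁ - m₂) • h : ℝ →₁[unitMeasure] ℝ) := by
  obtain ⟨u₁, v₁, hu₁, hv₁, h₁⟩ := exists_pow_sub_pow_eq hLK hmin hg₁ hh n
  obtain ⟨u₂, v₂, hu₂, hv₂, h₂⟩ := exists_pow_sub_pow_eq hLK hmin hg₂ hh n
  obtain ⟨A₁, hA₁e, hA₁, hA₁K⟩ := hu₁.exists_antitone_version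
  obtain ⟨B₁, hB₁e, hB₁, hB₁K⟩ := hv₁.exists_antitone_version
  obtain ⟨A₂, hA₂e, hA₂, hA₂K⟩ := hu₂.exists_antitone_version
  obtain ⟨B₂, hB₂e, hB₂, hB₂K⟩ := hv₂.exists_antitone_version
  have hρ : 0 ≤ r ^ (n / M) := by positivity
  have hanti {X Y : ℝ → ℝ} (hX : Antitone X) (hY : Antitone Y) :
      Antitone fun x => r ^ (n / M) * (m₁ * X x + m₂ * Y x) := fun x y hxy =>
    mul_le_mul_of_nonneg_left (add_le_add (mul_le_mul_of_nonneg_left (hX hxy) hm₁.1)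
      (mul_le_mul_of_nonneg_left (hY hxy) hm₂.1)) hρ
  have hbound {X Y : ℝ → ℝ} (hX : ∀ x, X x ∈ Icc 0 K) (hY : ∀ x, Y x ∈ Icc 0 K) (x : ℝ) :
      r ^ (n / M) * (m₁ * X x + m₂ * Y x) ∈ Icc 0 (r ^ (n / M) * (2 * C * K)) := by
    have hC := hm₁.1.trans hm₁.2
    have h1 := mul_le_mul hm₁.2 (hX x).2 (hX x).1 hC
    have h2 := mul_le_mul hm₂.2 (hY x).2 (hY x).1 hC
    have h3 := mul_nonneg hm₁.1 (hX x).1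
    have h4 := mul_nonneg hm₂.1 (hY x).1
    exact ⟨mul_nonneg hρ (add_nonneg h3 h4), mul_le_mul_of_nonneg_left (by linarith) hρ⟩
  refine ⟨_, _, hanti hA₁ hB₂, hanti hB₁ hA₂, hbound hA₁K hB₂K, hbound hB₁K hA₂K, ?_⟩
  have hsplit : (L ^ n) (m₁ • g₁ - m₂ • g₂) - (m₁ - m₂) • h =
      (r ^ (n / M)) • (m₁ • (u₁ - v₁) - m₂ • (u₂ - v₂)) := by
    rw [smul_sub, smul_comm _ m₁, smul_comm _ m₂, ← h₁, ← h₂, pow_apply_eq_self hfix, map_sub,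
      map_smul, map_smul]
    module
  rw [hsplit]
  filter_upwards [hA₁e, hB₁e, hA₂e, hB₂e,
    Lp.coeFn_smul (r ^ (n / M)) (m₁ • (u₁ - v₁) - m₂ • (u₂ - v₂)),
    Lp.coeFn_sub (m₁ • (u₁ - v₁)) (m₂ • (u₂ - v₂)), Lp.coeFn_smul m₁ (u₁ - v₁),
    Lp.coeFn_smul m₂ (u₂ - v₂), Lp.coeFn_sub u₁ v₁, Lp.coeFn_sub u₂ v₂]
    with x e₁ e₂ e₃ e₄ e₅ e₆ e₇ e₈ e₉ e₁₀
  simp only [e₁, e₂, e₃, e₄, e₅, e₆, e₇, e₈, e₉, e₁₀, Pi.smul_apply, Pi.sub_apply, smul_eq_mul]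
  ring

/-- Theorem 2.2.7 (3)–(4): spectral decomposition / quasi-compactness.
Let `τ ∈ 𝒯` with invariant density `h` (`P h = h`, `∫ h = 1`). Then there are `H > 0`
and `0 < q < 1` such that for all `f ∈ BV_I` and all `n ≥ 1`, some version `g` of
`P ⁿ f` satisfies `‖g − (∫ f dm)·h‖_BV ≤ H·qⁿ·‖f‖_BV`, where
`‖u‖_BV = ‖u‖₁ + var_I u`; i.e. `P = Ψ + Q`, `Ψ f = (∫ f dm)·h`, `QΨ = 0`,
`‖Qⁿ‖_BV ≤ H·qⁿ`. -/
theorem spectral_gap_of_frobeniusPerron (T : PCT) (P : (ℝ → ℝ) → (ℝ → ℝ))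
    (hP : ∀ f : ℝ → ℝ, MeasureTheory.IntegrableOn f (Set.Icc (0:ℝ) 1) →
      MeasureTheory.IntegrableOn (P f) (Set.Icc (0:ℝ) 1) ∧
      ∀ A : Set ℝ, MeasurableSet A → A ⊆ Set.Icc (0:ℝ) 1 →
        ∫ x in A, P f x = ∫ x in T.τ ⁻¹' A ∩ Set.Icc (0:ℝ) 1, f x)
    (h : ℝ → ℝ)
    (hh_int : MeasureTheory.IntegrableOn h (Set.Icc (0:ℝ) 1))
    (hh_nn : ∀ x ∈ Set.Icc (0:ℝ) 1, 0 ≤ h x)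
    (hh1 : ∫ x in Set.Icc (0:ℝ) 1, h x = 1)
    (hfix : P h =ᵐ[volume.restrict (Set.Icc (0:ℝ) 1)] h) :
    ∃ H q : ℝ, 0 < H ∧ 0 < q ∧ q < 1 ∧
      ∀ f : ℝ → ℝ, MeasureTheory.IntegrableOn f (Set.Icc (0:ℝ) 1) →
        BoundedVariationOn f (Set.Icc (0:ℝ) 1) →
      ∀ n : ℕ, 1 ≤ n →
        ∃ g : ℝ → ℝ, g =ᵐ[volume.restrict (Set.Icc (0:ℝ) 1)] P^[n] f ∧
          ENNReal.ofReal (∫ x in Set.Icc (0:ℝ) 1,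
              |g x - (∫ t in Set.Icc (0:ℝ) 1, f t) * h x|) +
            eVariationOn (fun x => g x - (∫ t in Set.Icc (0:ℝ) 1, f t) * h x)
              (Set.Icc (0:ℝ) 1) ≤
          ENNReal.ofReal (H * q ^ n) *
            (ENNReal.ofReal (∫ x in Set.Icc (0:ℝ) 1, |f x|) +
              eVariationOn f (Set.Icc (0:ℝ) 1)) := by
  obtain ⟨L, hL, hLP⟩ := exists_isTransferOperator T P hP
  obtain ⟨α, D, hα, hα1, hD, hc⟩ := IsTransferOperator.exists_contraction T
  have h1α : 0 < 1 - α := sub_pos.2 hα1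
  set K := max 2 (2 * D / (1 - α))
  have hK : 2 ≤ K := le_max_left _ _
  have hDK : 2 * D ≤ (1 - α) * K := (div_le_iff₀' h1α).1 (le_max_right _ _)
  have hLK (u) (hu : IsConcaveCdf K (cumulative u)) : IsConcaveCdf K (cumulative (L u)) :=
    (hc hL hu).of_le (by nlinarith)
  obtain ⟨M, η, ψ, hM, hη, hη1, hmin⟩ := hL.exists_minorization hα hα1 (by linarith) hDK (hc hL)
  have hr : 0 < 1 - η := sub_pos.2 hη1
  have hr1 : 1 - η < 1 := sub_lt_self _ hη
  set h' : ℝ →₁[unitMeasure] ℝ := Integrable.toL1 h hh_int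
  have hh'h : h' =ᵐ[unitMeasure] h := Integrable.coeFn_toL1 hh_int
  have hfix' : L h' = h' := Lp.ext ((hLP h' h hh'h).trans (hfix.trans hh'h.symm))
  have hhK := hL.isConcaveCdf_of_fixed hM hK hr.le hr1 hLK hmin hfix'
    ((integral_congr_ae hh'h).trans hh1)
  obtain ⟨q, hq, hq1, hqn⟩ := pow_div_le_mul_pow hr hr1 hM
  refine ⟨36 * K * (1 - η)⁻¹, q, by positivity, hq, hq1, fun f hfi hf n _ => ?_⟩
  obtain ⟨m₁, m₂, g₁, g₂, hm₁, hm₂, hg₁, hg₂, hdec⟩ := exists_decomposition hK hfi hf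
  set N := (∫ x, |f x| ∂unitMeasure) + (eVariationOn f (Icc 0 1)).toReal with hN
  obtain ⟨A, B, hA, hB, hAR, hBR, hAB⟩ :=
    exists_antitone_sub_version hr.le hLK hmin hfix' hhK hg₁ hg₂ hm₁ hm₂ n
  set R := (1 - η) ^ (n / M) * (2 * (6 * N) * K) with hR
  have hff : (hfi.toL1 f : ℝ →₁[unitMeasure] ℝ) =ᵐ[unitMeasure] f := Integrable.coeFn_toL1 hfi
  have hintf : ∫ t in Icc (0:ℝ) 1, f t = m₁ - m₂ := by
    rw [← integral_smul_sub_smul (m₁ := m₁) (m₂ := m₂) hg₁ hg₂, ← hdec]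
    exact (integral_congr_ae hff).symm
  have hiter (k : ℕ) : (L ^ k) (hfi.toL1 f) =ᵐ[unitMeasure] P^[k] f := by
    induction k with
    | zero => exact hff
    | succ k ih =>
      rw [pow_succ', mul_apply_eq_comp, Function.iterate_succ_apply']
      exact hLP _ _ ih
  have hN0 : 0 ≤ N := by linarith [hm₁.1.trans hm₁.2]
  refine ⟨fun x => (A x - B x) + (∫ t in Icc (0:ℝ) 1, f t) * h x, ?_, ?_⟩
  · rw [← hdec] at hAB
    filter_upwards [hAB, hiter n, hh'h, Lp.coeFn_sub ((L ^ n) (hfi.toL1 f)) ((m₁ - m₂) • h'),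
      Lp.coeFn_smul (m₁ - m₂) h'] with x e₁ e₂ e₃ e₄ e₅
    rw [e₁, e₄, Pi.sub_apply, e₅, Pi.smul_apply, e₂, e₃, hintf, smul_eq_mul, sub_add_cancel]
  · simp only [add_sub_cancel_right]
    have h1 : ∫ x in Icc (0:ℝ) 1, |A x - B x| ≤ R := by
      have h2 : ∫ x, |A x - B x| ∂unitMeasure ≤ ∫ _, R ∂unitMeasure := by
        refine integral_mono_of_nonneg (ae_of_all _ fun x => abs_nonneg _) (integrable_const _)
          (ae_of_all _ fun x => abs_le.2 ⟨?_, ?_⟩)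
        · linarith [(hAR x).1, (hBR x).2]
        · linarith [(hAR x).2, (hBR x).1]
      simpa using h2
    have hR0 : 0 ≤ R := (hAR 0).1.trans (hAR 0).2
    have hRq : 3 * R ≤ 36 * K * (1 - η)⁻¹ * q ^ n * N := by
      have h3 := mul_le_mul_of_nonneg_right (hqn n) (show 0 ≤ 36 * K * N by positivity)
      rw [hR]
      linarith
    calc _ ≤ ENNReal.ofReal R + ENNReal.ofReal (2 * R) :=
          add_le_add (ENNReal.ofReal_le_ofReal h1) (eVariationOn_sub_le_of_antitone hA hB hAR hBR _)
      _ = ENNReal.ofReal (3 * R) := by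
          rw [← ENNReal.ofReal_add hR0 (by positivity)]
          ring_nf
      _ ≤ ENNReal.ofReal (36 * K * (1 - η)⁻¹ * q ^ n * N) := ENNReal.ofReal_le_ofReal hRq
      _ = _ := by
          rw [ENNReal.ofReal_mul (by positivity), hN,
            ENNReal.ofReal_add (integral_nonneg fun x => abs_nonneg _) ENNReal.toReal_nonneg,
            ENNReal.ofReal_toReal hf]
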